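/- arXiv:1803.05800 — 4 statements merged into one kernel-verified Lean document; each statement's English description precedes it below -/
import Mathlib

section
/- Let m ≥ 3 be an odd integer. There exist infinitely many odd positive integers x such that the imaginary quadratic field k = ℚ(√(1−x^m)) satisfies rank_m Cl(k) ≥ 1, i.e. the ideal class group of ℚ(√(1−x^m)) contains an element of order m. -/
open NumberField IntermediateField

/-- In a Dedekind domain, if `a` and `b` are coprime with `a * b = c ^ m`, and `a` is not a unit times
a `p`-th power for any prime `p ∣ m`, then the class group has an element of order `m`. -/
theorem exists_orderOf_classGroup_eq {R : Type*} [CommRing R] [IsDedekindDomain R]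
    {a b c : R} {m : ℕ} (hm : 0 < m) (ha : a ≠ 0) (hab : IsCoprime a b) (h : a * b = c ^ m)
    (hp : ∀ p : ℕ, p.Prime → p ∣ m → ∀ (u : Rˣ) (β : R), a ≠ u * β ^ p) :
    ∃ C : ClassGroup R, orderOf C = m := by
  have hgcd : IsUnit (gcd (Ideal.span {a}) (Ideal.span {b})) := by
    rw [Ideal.isCoprime_iff_gcd.1 ((Ideal.isCoprime_span_singleton_iff a b).2 hab)]
    exact isUnit_one
  obtain ⟨I, hI⟩ := exists_eq_pow_of_mul_eq_pow hgcd (c := Ideal.span {c}) (k := m)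
    (by rw [Ideal.span_singleton_mul_span_singleton, Ideal.span_singleton_pow, h])
  have hI0 : I ∈ nonZeroDivisors (Ideal R) := by
    rw [mem_nonZeroDivisors_iff_ne_zero]
    rintro rfl
    rw [zero_pow hm.ne', Ideal.zero_eq_bot, Ideal.span_singleton_eq_bot] at hI
    exact ha hI
  have hpow : ∀ k : ℕ, ClassGroup.mk0 ⟨I, hI0⟩ ^ k = 1 ↔ (I ^ k).IsPrincipal := fun k ↦ by
    rw [← map_pow, ← ClassGroup.mk0_eq_one_iff (pow_mem hI0 k)]
    rfl
  refine ⟨ClassGroup.mk0 ⟨I, hI0⟩, orderOf_eq_of_pow_and_pow_div_prime hm ?_ ?_⟩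
  · rw [hpow, ← hI]
    exact ⟨a, rfl⟩
  · intro p hpp hpm hone
    obtain ⟨β, hβ⟩ := (hpow _).1 hone
    have hspan : Ideal.span {β ^ p} = Ideal.span {a} := by
      rw [hI, ← Ideal.span_singleton_pow, Ideal.span, ← hβ, ← pow_mul, Nat.div_mul_cancel hpm]
    obtain ⟨u, hu⟩ := Ideal.span_singleton_eq_span_singleton.1 hspan
    exact hp p hpp hpm u β (by rw [← hu, mul_comm])

/-- Elements of `F(z)` with `z ^ 2 ∈ F` have the form `r + s z`. -/
theorem exists_eq_add_mul_of_mem_adjoin {F E : Type*} [Field F] [Field E] [Algebra F E] {z : E}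
    {d : F} (hz : z ^ 2 = algebraMap F E d) {w : E} (hw : w ∈ adjoin F {z}) :
    ∃ r s : F, w = algebraMap F E r + algebraMap F E s * z := by
  induction hw using adjoin_induction with
  | mem x hx => exact ⟨0, 1, by simp_all⟩
  | algebraMap x => exact ⟨x, 0, by simp⟩
  | add x y _ _ hx hy =>
    obtain ⟨r, s, rfl⟩ := hx
    obtain ⟨r', s', rfl⟩ := hy
    exact ⟨r + r', s + s', by push_cast [map_add]; ring⟩
  | mul x y _ _ hx hy =>
    obtain ⟨r, s, rfl⟩ := hx
    obtain ⟨r', s', rfl⟩ := hy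
    refine ⟨r * r' + s * s' * d, r * s' + s * r', ?_⟩
    simp only [map_add, map_mul, ← hz]
    ring
  | inv x _ hx =>
    obtain ⟨r, s, rfl⟩ := hx
    by_cases h0 : algebraMap F E r + algebraMap F E s * z = 0
    · exact ⟨0, 0, by simp [h0]⟩
    by_cases h1 : algebraMap F E r - algebraMap F E s * z = 0
    · refine ⟨(2 * r)⁻¹, 0, ?_⟩
      rw [← sub_eq_zero.1 h1]
      simp [two_mul]
    · have hd : (r ^ 2 - s ^ 2 * d : F) ≠ 0 := by
        intro h
        have := mul_ne_zero h0 h1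
        apply this
        have h' := congrArg (algebraMap F E) h
        simp only [map_sub, map_mul, map_pow, map_zero, ← hz] at h'
        linear_combination h'
      have hd' : algebraMap F E r ^ 2 - algebraMap F E s ^ 2 * z ^ 2 ≠ 0 := by
        rw [hz, ← map_pow, ← map_pow, ← map_mul, ← map_sub]
        exact (map_ne_zero _).2 hd
      refine ⟨r / (r ^ 2 - s ^ 2 * d), -s / (r ^ 2 - s ^ 2 * d), ?_⟩
      simp only [map_div₀, map_sub, map_mul, map_pow, map_neg, ← hz]
      field_simp
      ring

/-- An algebraic integer that is a rational number is an integer. -/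
theorem exists_int_eq_of_isIntegral_ratCast {q : ℚ} (h : IsIntegral ℤ (q : ℂ)) :
    ∃ n : ℤ, q = n := by
  have hq : IsIntegral ℤ q :=
    (isIntegral_algebraMap_iff (A := ℚ) (B := ℂ) (algebraMap ℚ ℂ).injective).1 (by simpa using h)
  obtain ⟨n, hn⟩ := IsIntegrallyClosed.isIntegral_iff.1 hq
  exact ⟨n, by simpa using hn.symm⟩

theorem conj_eq_neg_of_sq_eq_neg {z : ℂ} {n : ℕ} (hn : 0 < n) (hz : z ^ 2 = -(n : ℂ)) :
    starRingEnd ℂ z = -z := by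
  have hre := congrArg Complex.re hz
  have him := congrArg Complex.im hz
  simp only [pow_two, Complex.mul_re, Complex.mul_im, Complex.neg_re, Complex.neg_im,
    Complex.natCast_re, Complex.natCast_im] at hre him
  have hn' : (0 : ℝ) < n := by exact_mod_cast hn
  have h0 : z.re * z.im = 0 := by linarith
  have hzre : z.re = 0 := by
    rcases mul_eq_zero.1 h0 with h | h
    · exact h
    · rw [h] at hre
      nlinarith [sq_nonneg z.re]
  apply Complex.ext <;> simp [hzre]

theorem isIntegral_conj {w : ℂ} (hw : IsIntegral ℤ w) : IsIntegral ℤ (starRingEnd ℂ w) :=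
  hw.map (starRingEnd ℂ).toIntAlgHom

/-- An integer of `ℚ(√-n)` is `r + s √-n` with integral trace `2 r` and integral norm
`r ^ 2 + s ^ 2 n`. -/
theorem exists_trace_norm_of_isIntegral {z : ℂ} {n : ℕ} (hn : 0 < n) (hz : z ^ 2 = -(n : ℂ)) {w : ℂ}
    (hw : w ∈ adjoin ℚ {z}) (hint : IsIntegral ℤ w) :
    ∃ (r s : ℚ) (t N : ℤ), w = r + s * z ∧ 2 * r = t ∧ r ^ 2 + s ^ 2 * n = N ∧
      w + starRingEnd ℂ w = t ∧ w * starRingEnd ℂ w = N := by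
  obtain ⟨r, s, hrs⟩ := exists_eq_add_mul_of_mem_adjoin (d := -(n : ℚ)) (by simpa using hz) hw
  simp only [eq_ratCast] at hrs
  have hconj : starRingEnd ℂ w = r - s * z := by
    rw [hrs, map_add, map_mul, conj_eq_neg_of_sq_eq_neg hn hz]
    simp only [map_ratCast]
    ring
  have htr : w + starRingEnd ℂ w = ((2 * r : ℚ) : ℂ) := by
    rw [hconj, hrs]; push_cast; ring
  have hnm : w * starRingEnd ℂ w = ((r ^ 2 + s ^ 2 * n : ℚ) : ℂ) := by
    rw [hconj, hrs]; push_cast; linear_combination (-(s : ℂ) ^ 2) * hz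
  obtain ⟨t, ht⟩ := exists_int_eq_of_isIntegral_ratCast (htr ▸ hint.add (isIntegral_conj hint))
  obtain ⟨N, hN⟩ := exists_int_eq_of_isIntegral_ratCast (hnm ▸ hint.mul (isIntegral_conj hint))
  exact ⟨r, s, t, N, hrs, ht, hN, by rw [htr, ht]; simp, by rw [hnm, hN]; simp⟩

/-- The odd `2`-adic valuation of `n` obstructs `b ^ 2 * n = c` for `c` of even valuation. -/
theorem sq_mul_ne_of_mod_four_eq_two {n : ℕ} (hn : n % 4 = 2) {c : ℚ} (hc0 : c ≠ 0)
    (hc : Even (padicValRat 2 c)) (b : ℚ) : b ^ 2 * n ≠ c := by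
  intro h
  have hb : b ≠ 0 := by rintro rfl; simp at h; exact hc0 h.symm
  have hn0 : (n : ℚ) ≠ 0 := by norm_cast; omega
  have hv : padicValRat 2 (n : ℚ) = 1 := by
    obtain ⟨k, hk⟩ : ∃ k, n = 2 * k := ⟨n / 2, by omega⟩
    have hk0 : k ≠ 0 := by omega
    have h2k : ¬ 2 ∣ k := by omega
    rw [padicValRat.of_nat, hk, padicValNat.mul two_ne_zero hk0,
      padicValNat.eq_zero_of_not_dvd h2k, padicValNat_self]
    rfl
  rw [← h, padicValRat.mul (pow_ne_zero 2 hb) hn0, padicValRat.pow, hv] at hc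
  obtain ⟨k, hk⟩ := hc
  push_cast at hk
  omega

/-- If `w` and its inverse are integers of `ℚ(√-n)` with `n ≡ 2 mod 4`, then `w = ±1`. -/
theorem eq_one_or_neg_one_of_isIntegral_of_mul_eq_one {z : ℂ} {n : ℕ} (hn : n % 4 = 2)
    (hz : z ^ 2 = -(n : ℂ)) {w v : ℂ} (hw : w ∈ adjoin ℚ {z}) (hv : v ∈ adjoin ℚ {z})
    (hwi : IsIntegral ℤ w) (hvi : IsIntegral ℤ v) (hwv : w * v = 1) : w = 1 ∨ w = -1 := by
  have hn0 : 0 < n := by omega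
  obtain ⟨r, s, t, N, hrs, ht, hN, -, hN'⟩ := exists_trace_norm_of_isIntegral hn0 hz hw hwi
  obtain ⟨r', s', -, M, -, -, hM, -, hM'⟩ := exists_trace_norm_of_isIntegral hn0 hz hv hvi
  have hNM : N * M = 1 := by
    have h : (N : ℂ) * M = 1 := by
      rw [← hN', ← hM']
      calc _ = (w * v) * starRingEnd ℂ (w * v) := by rw [map_mul]; ring
        _ = 1 := by rw [hwv]; simp
    exact_mod_cast h
  have hN0 : 0 ≤ N := by
    have : (0 : ℚ) ≤ N := by rw [← hN]; positivity
    exact_mod_cast this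
  have hN1 : N = 1 := by
    rcases Int.eq_one_or_neg_one_of_mul_eq_one hNM with h | h <;> omega
  have hkey : (2 * s) ^ 2 * n = 4 - (t : ℚ) ^ 2 := by
    rw [← ht]
    rw [hN1] at hN
    push_cast at hN
    linear_combination 4 * hN
  have ht4 : t ^ 2 ≤ 4 := by
    have : (t : ℚ) ^ 2 ≤ 4 := by
      have : 0 ≤ (2 * s) ^ 2 * (n : ℚ) := by positivity
      linarith
    exact_mod_cast this
  have hv3 : padicValRat 2 (3 : ℚ) = 0 := by
    rw [show (3 : ℚ) = ((3 : ℕ) : ℚ) by norm_num, padicValRat.of_nat,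
      padicValNat.eq_zero_of_not_dvd (by norm_num)]
    rfl
  have hv4 : padicValRat 2 (4 : ℚ) = 2 := by
    rw [show (4 : ℚ) = ((2 ^ 2 : ℕ) : ℚ) by norm_num, padicValRat.of_nat, padicValNat.prime_pow]
    rfl
  have hs0 : 4 - (t : ℚ) ^ 2 = 0 → s = 0 := fun h ↦ by
    have hnq : (n : ℚ) ≠ 0 := by exact_mod_cast hn0.ne'
    simpa [h, hnq] using hkey
  have hl : -2 ≤ t := by nlinarith
  have hu : t ≤ 2 := by nlinarith
  interval_cases t
  · right
    rw [hrs, hs0 (by norm_num), show r = -1 by push_cast at ht; linarith]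
    simp
  · exact absurd hkey (sq_mul_ne_of_mod_four_eq_two hn (by norm_num) (by norm_num [hv3]) _)
  · exact absurd hkey (sq_mul_ne_of_mod_four_eq_two hn (by norm_num) (by norm_num [hv4]) _)
  · exact absurd hkey (sq_mul_ne_of_mod_four_eq_two hn (by norm_num) (by norm_num [hv3]) _)
  · left
    rw [hrs, hs0 (by norm_num), show r = 1 by push_cast at ht; linarith]
    simp

/-- The power sums of the roots of `X ^ 2 - t X + y` are congruent to `t ^ k` modulo `y`. -/
theorem exists_pow_add_pow_eq {R : Type*} [CommRing R] {a b : R} {t y : ℤ} (hab : a + b = t)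
    (hy : a * b = y) (k : ℕ) :
    ∃ q : ℤ, a ^ (k + 1) + b ^ (k + 1) = ((t ^ (k + 1) + y * q : ℤ) : R) := by
  suffices ∀ k : ℕ, (∃ q : ℤ, a ^ (k + 1) + b ^ (k + 1) = ((t ^ (k + 1) + y * q : ℤ) : R)) ∧
      ∃ q : ℤ, a ^ (k + 2) + b ^ (k + 2) = ((t ^ (k + 2) + y * q : ℤ) : R) from (this k).1
  intro k
  induction k with
  | zero =>
    refine ⟨⟨0, by simpa using hab⟩, ⟨-2, ?_⟩⟩
    push_cast
    rw [← hab, ← hy]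
    ring
  | succ k ih =>
    obtain ⟨⟨q, hq⟩, q', hq'⟩ := ih
    refine ⟨⟨q', hq'⟩, t * q' - t ^ (k + 1) - y * q, ?_⟩
    have : a ^ (k + 1 + 2) + b ^ (k + 1 + 2) =
        (a + b) * (a ^ (k + 2) + b ^ (k + 2)) - a * b * (a ^ (k + 1) + b ^ (k + 1)) := by ring
    rw [this, hq, hq', hab, hy]
    push_cast
    ring

/-- For `n + 1 = x ^ m` with `x` large, `1 - √-n` is not a `p`-th power of an integer
of `ℚ(√-n)`. -/
theorem one_sub_ne_pow {z : ℂ} {n x m p : ℕ} (hn : 0 < n) (hnx : n + 1 = x ^ m)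
    (hx : 2 ^ m + 2 < x) (hz : z ^ 2 = -(n : ℂ)) (hp : 3 ≤ p) (hpo : Odd p) (hpm : p ∣ m)
    (hm : 0 < m) {w : ℂ} (hw : w ∈ adjoin ℚ {z}) (hint : IsIntegral ℤ w) : 1 - z ≠ w ^ p := by
  intro h
  obtain ⟨r, s, t, N, -, -, hN, ht, hN'⟩ := exists_trace_norm_of_isIntegral hn hz hw hint
  have hconj : 1 + z = starRingEnd ℂ w ^ p := by
    rw [← map_pow, ← h, map_sub, conj_eq_neg_of_sq_eq_neg hn hz]
    simp
  have hsum : w ^ p + starRingEnd ℂ w ^ p = 2 := by rw [← h, ← hconj]; ring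
  have hNp : N ^ p = (x : ℤ) ^ m := by
    have : (N : ℂ) ^ p = (x : ℂ) ^ m := by
      rw [← hN', mul_pow, ← h, ← hconj]
      have : (n : ℂ) + 1 = (x : ℂ) ^ m := by exact_mod_cast hnx
      linear_combination this - hz
    exact_mod_cast this
  have hxN : (x : ℤ) ∣ N := by
    obtain ⟨e, rfl⟩ := hpm
    have he : e ≠ 0 := by rintro rfl; simp at hm
    rw [mul_comm, pow_mul] at hNp
    rw [hpo.strictMono_pow.injective hNp]
    exact dvd_pow_self _ he
  have ht2 : t ∣ 2 := by
    let a : integralClosure ℤ ℂ := ⟨w, hint⟩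
    let b : integralClosure ℤ ℂ := ⟨starRingEnd ℂ w, isIntegral_conj hint⟩
    obtain ⟨c, hc⟩ := hpo.add_dvd_pow_add_pow a b
    have hc' : (2 : ℂ) = t * c := by
      rw [← hsum, ← ht]
      exact congrArg Subtype.val hc
    have ht0 : (t : ℂ) ≠ 0 := by
      intro h0
      rw [h0, zero_mul] at hc'
      exact two_ne_zero hc'
    have hcq : (c : ℂ) = ((2 / t : ℚ) : ℂ) := by
      push_cast
      rw [hc', mul_div_cancel_left₀ _ ht0]
    obtain ⟨k, hk⟩ := exists_int_eq_of_isIntegral_ratCast (hcq ▸ c.2)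
    refine ⟨k, ?_⟩
    rw [hcq, hk] at hc'
    exact_mod_cast hc'
  obtain ⟨q, hq⟩ := exists_pow_add_pow_eq ht hN' (p - 1)
  rw [Nat.sub_add_cancel (by omega), hsum] at hq
  have hq' : 2 = t ^ p + N * q := by exact_mod_cast hq
  have hdvd : (x : ℤ) ∣ t ^ p - 2 := by
    obtain ⟨e, he⟩ := hxN
    exact ⟨-(e * q), by rw [hq', he]; ring⟩
  have ht0 : t ≠ 0 := by rintro rfl; simp at ht2
  have habs : |t| ≤ 2 := Int.le_of_dvd two_pos ((abs_dvd _ _).2 ht2)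
  have hbound : |t ^ p - 2| < x := by
    have h1 : |t ^ p| ≤ 2 ^ m := by
      rw [abs_pow]
      calc |t| ^ p ≤ 2 ^ p := pow_le_pow_left₀ (abs_nonneg _) habs p
        _ ≤ 2 ^ m := pow_le_pow_right₀ (by norm_num) (Nat.le_of_dvd hm hpm)
    have h2 : (2 : ℤ) ^ m + 2 < x := by exact_mod_cast hx
    calc |t ^ p - 2| ≤ |t ^ p| + |2| := abs_sub _ _
      _ ≤ 2 ^ m + 2 := by gcongr; norm_num
      _ < x := h2
  have h0 := Int.eq_zero_of_abs_lt_dvd hdvd hbound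
  have h8 : t ^ p = 2 := by omega
  have hev : Even t := by
    by_contra hc
    have := (Int.not_even_iff_odd.1 hc).pow (n := p)
    rw [h8] at this
    exact absurd this (by decide)
  obtain ⟨c, hc⟩ := hev
  have : (2 : ℤ) ^ 2 ∣ t ^ p :=
    (pow_dvd_pow_of_dvd ⟨c, by omega⟩ 2).trans (pow_dvd_pow t (by omega))
  rw [h8] at this
  norm_num at this

theorem exists_orderOf_classGroup_adjoin_eq {m x : ℕ} (hm : 3 ≤ m) (hmodd : Odd m)
    (hx4 : x % 4 = 3) (hx : 2 ^ m + 2 < x) {z : ℂ} (hz : z ^ 2 = 1 - (x : ℂ) ^ m) :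
    ∃ C : ClassGroup (𝓞 ↥(adjoin ℚ {z})), orderOf C = m := by
  have hpow4 : x ^ m % 4 = 3 := by
    obtain ⟨k, rfl⟩ := hmodd
    rw [Nat.pow_mod, hx4, pow_succ, pow_mul, Nat.mul_mod, Nat.pow_mod]
    norm_num
  obtain ⟨n, hn⟩ : ∃ n, n + 1 = x ^ m := ⟨x ^ m - 1, by omega⟩
  have hn4 : n % 4 = 2 := by omega
  have hzn : z ^ 2 = -(n : ℂ) := by
    rw [hz, ← Nat.cast_pow, ← hn]
    push_cast
    ring
  have hzint : IsIntegral ℤ z := by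
    refine IsIntegral.of_pow two_pos ?_
    rw [hz]
    exact isIntegral_one.sub ((isIntegral_natCast ..).pow m)
  have : FiniteDimensional ℚ ↥(adjoin ℚ {z}) := adjoin.finiteDimensional hzint.tower_top
  have : NumberField ↥(adjoin ℚ {z}) := {}
  let ι : 𝓞 ↥(adjoin ℚ {z}) →+* ℂ := (algebraMap ↥(adjoin ℚ {z}) ℂ).comp (algebraMap _ _)
  have hι : Function.Injective ι :=
    (algebraMap ↥(adjoin ℚ {z}) ℂ).injective.comp RingOfIntegers.coe_injective
  have hmem : ∀ a, ι a ∈ adjoin ℚ {z} := fun a ↦ (a : ↥(adjoin ℚ {z})).2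
  have hint : ∀ a, IsIntegral ℤ (ι a) := fun a ↦ (RingOfIntegers.isIntegral a).map ι.toIntAlgHom
  obtain ⟨ζ, hζ⟩ : ∃ ζ, ι ζ = z := by
    let y : ↥(adjoin ℚ {z}) := ⟨z, mem_adjoin_simple_self ℚ z⟩
    have hy : IsIntegral ℤ y :=
      (isIntegral_algebraMap_iff (algebraMap ↥(adjoin ℚ {z}) ℂ).injective).1 hzint
    exact ⟨⟨y, hy⟩, rfl⟩
  have hmul : (1 - ζ) * (1 + ζ) = (x : 𝓞 ↥(adjoin ℚ {z})) ^ m := by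
    apply hι
    simp only [map_mul, map_sub, map_add, map_one, map_pow, map_natCast, hζ]
    linear_combination -hz
  have hne : (1 - ζ) ≠ 0 := by
    intro h
    rw [h, zero_mul] at hmul
    exact pow_ne_zero m (Nat.cast_ne_zero.2 (by omega)) hmul.symm
  have hcop : IsCoprime (1 - ζ) (1 + ζ) := by
    obtain ⟨k, hk⟩ : ∃ k, x ^ m = 2 * k + 1 := ⟨x ^ m / 2, by omega⟩
    have hk' : (1 - ζ) * (1 + ζ) = 2 * k + 1 := by rw [hmul]; exact_mod_cast hk
    exact ⟨1 + ζ - k, -k, by linear_combination hk'⟩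
  refine exists_orderOf_classGroup_eq (by omega) hne hcop hmul fun p hp hpm u β h ↦ ?_
  have hpo : Odd p := hmodd.of_dvd_nat hpm
  have hp3 : 3 ≤ p := by
    have := hp.two_le
    rcases hpo with ⟨k, rfl⟩
    omega
  have h' : 1 - z = ι u * ι β ^ p := by simpa [hζ] using congrArg ι h
  have huv : ι u * ι ↑u⁻¹ = 1 := by rw [← map_mul, Units.mul_inv, map_one]
  rcases eq_one_or_neg_one_of_isIntegral_of_mul_eq_one hn4 hzn (hmem _) (hmem _) (hint _) (hint _)
    huv with hu | hu
  · refine one_sub_ne_pow (by omega) hn hx hzn hp3 hpo hpm (by omega) (hmem β) (hint β) ?_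
    rw [h', hu, one_mul]
  · refine one_sub_ne_pow (by omega) hn hx hzn hp3 hpo hpm (by omega) (hmem (-β)) (hint (-β)) ?_
    rw [h', hu, map_neg, hpo.neg_pow, neg_one_mul]
/-- Let `m ≥ 3` be an odd integer. There exist infinitely many odd positive
integers `x` such that the imaginary quadratic field `k = ℚ(√(1 − x^m))` satisfies
`rank_m Cl(k) ≥ 1`, i.e. the ideal class group of `ℚ(√(1 − x^m))` contains an element of
order `m`. -/
theorem large_class_groups_toy_example (m : ℕ) (hm : 3 ≤ m) (hmodd : Odd m) :
    {x : ℕ | Odd x ∧ 0 < x ∧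
      ∀ z : ℂ, z ^ 2 = 1 - (x : ℂ) ^ m →
        ∃ C : ClassGroup (𝓞 ↥(IntermediateField.adjoin ℚ {z})), orderOf C = m}.Infinite := by
  refine Set.infinite_of_injective_forall_mem (f := fun k : ℕ ↦ 4 * (k + 2 ^ m) + 3)
    (fun a b h ↦ by simpa using h) fun k ↦ ⟨⟨2 * (k + 2 ^ m) + 1, by ring⟩, by positivity, ?_⟩
  intro z hz
  have := Nat.one_le_two_pow (n := m)
  exact exists_orderOf_classGroup_adjoin_eq hm hmodd (by omega) (by omega) hz
end

section
/- Let m ≥ 3 be an odd integer. There is a constant c > 0 such that for all sufficiently large X, the number of isomorphism classes of imaginary quadratic fields k with |Disc(k)| < X and rank_m Cl(k) ≥ 1 is at least c·X^(1/m)/log X. -/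
open NumberField

/-- The imaginary quadratic field `ℚ(√-d)`, as a subfield of `ℂ`. -/
noncomputable def imagQuadField (d : ℕ) : Subfield ℂ where
  carrier := {z | ∃ u v : ℚ, z = u + v * (√(d : ℝ) * Complex.I)}
  mul_mem' := by
    rintro _ _ ⟨a, b, rfl⟩ ⟨a', b', rfl⟩
    have hs : ((√(d : ℝ) : ℝ) : ℂ) ^ 2 = d := by
      exact_mod_cast Real.sq_sqrt (Nat.cast_nonneg d)
    refine ⟨a * a' - d * (b * b'), a * b' + a' * b, ?_⟩
    push_cast
    linear_combination (b * b' * Complex.I ^ 2 : ℂ) * hs + (b * b' * d : ℂ) * Complex.I_sq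
  one_mem' := ⟨1, 0, by simp⟩
  add_mem' := by
    rintro _ _ ⟨a, b, rfl⟩ ⟨a', b', rfl⟩
    exact ⟨a + a', b + b', by push_cast; ring⟩
  zero_mem' := ⟨0, 0, by simp⟩
  neg_mem' := by
    rintro _ ⟨a, b, rfl⟩
    exact ⟨-a, -b, by push_cast; ring⟩
  inv_mem' := by
    rintro _ ⟨a, b, rfl⟩
    have hs : ((√(d : ℝ) : ℝ) : ℂ) ^ 2 = d := by
      exact_mod_cast Real.sq_sqrt (Nat.cast_nonneg d)
    by_cases h : (a + b * (√(d : ℝ) * Complex.I) : ℂ) = 0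
    · exact ⟨0, 0, by simp [h]⟩
    have hmul : (a + b * (√(d : ℝ) * Complex.I) : ℂ) * (a - b * (√(d : ℝ) * Complex.I)) =
        ((a ^ 2 + d * b ^ 2 : ℚ) : ℂ) := by
      push_cast
      linear_combination (-b ^ 2 * Complex.I ^ 2 : ℂ) * hs - (b ^ 2 * d : ℂ) * Complex.I_sq
    refine ⟨a / (a ^ 2 + d * b ^ 2), -b / (a ^ 2 + d * b ^ 2), ?_⟩
    have h' : (a - b * (√(d : ℝ) * Complex.I) : ℂ) ≠ 0 := by
      intro h0
      apply h
      have hc := congrArg (starRingEnd ℂ) h0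
      simpa using hc
    have hN : ((a ^ 2 + d * b ^ 2 : ℚ) : ℂ) ≠ 0 := hmul ▸ mul_ne_zero h h'
    apply inv_eq_of_mul_eq_one_right
    have hw : ((a / (a ^ 2 + d * b ^ 2) : ℚ) + (-b / (a ^ 2 + d * b ^ 2) : ℚ) *
        (√(d : ℝ) * Complex.I) : ℂ) =
        (a - b * (√(d : ℝ) * Complex.I)) / ((a ^ 2 + d * b ^ 2 : ℚ) : ℂ) := by
      push_cast
      ring
    rw [hw, ← mul_div_assoc, hmul, div_self hN]

namespace imagQuadField

variable {d : ℕ}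

/-- The generator `√-d` of `imagQuadField d`. -/
noncomputable def gen (d : ℕ) : imagQuadField d :=
  ⟨√(d : ℝ) * Complex.I, 0, 1, by simp⟩

lemma coe_gen : (gen d : ℂ) = √(d : ℝ) * Complex.I := rfl

lemma gen_sq : gen d ^ 2 = -(d : imagQuadField d) := by
  have hs : ((√(d : ℝ) : ℝ) : ℂ) ^ 2 = d := by
    exact_mod_cast Real.sq_sqrt (Nat.cast_nonneg d)
  apply Subtype.ext
  push_cast [coe_gen]
  rw [mul_pow, hs, Complex.I_sq]
  simp

lemma exists_eq (z : imagQuadField d) : ∃ u v : ℚ, z = u + v * gen d := by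
  obtain ⟨u, v, h⟩ := z.2
  exact ⟨u, v, Subtype.ext (by push_cast [coe_gen]; exact h)⟩

lemma normSq_eq (u v : ℚ) :
    Complex.normSq ((u + v * gen d : imagQuadField d) : ℂ) = ((u ^ 2 + d * v ^ 2 : ℚ) : ℝ) := by
  have hs : √(d : ℝ) ^ 2 = d := Real.sq_sqrt (Nat.cast_nonneg d)
  push_cast [coe_gen]
  rw [Complex.normSq_apply]
  simp
  linear_combination (v ^ 2 : ℝ) * hs

lemma eq_of_coe_eq (hd : 0 < d) {u v u' v' : ℚ}
    (h : (u + v * gen d : imagQuadField d) = u' + v' * gen d) : u = u' ∧ v = v' := by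
  have h1 := congrArg (fun z : imagQuadField d ↦ (z : ℂ)) h
  push_cast [coe_gen] at h1
  have hs : √(d : ℝ) ≠ 0 := by positivity
  have hre := congrArg Complex.re h1
  have him := congrArg Complex.im h1
  simp [hs] at hre him
  exact ⟨hre, him⟩

/-- The basis `1, √-d` of `imagQuadField d` over `ℚ`. -/
noncomputable def basis (hd : 0 < d) : Module.Basis (Fin 2) ℚ (imagQuadField d) :=
  Module.Basis.mk (v := ![1, gen d])
    (by
      rw [LinearIndependent.pair_iff]
      intro s t h
      have h' : ((s : ℚ) + (t : ℚ) * gen d : imagQuadField d) = (0 : ℚ) + (0 : ℚ) * gen d := by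
        simpa [Rat.smul_def] using h
      exact eq_of_coe_eq hd h')
    (by
      rintro z -
      obtain ⟨u, v, rfl⟩ := exists_eq z
      rw [Matrix.range_cons, Matrix.range_cons, Matrix.range_empty, Set.union_empty,
        Set.singleton_union, Submodule.mem_span_pair]
      exact ⟨u, v, by simp [Rat.smul_def]⟩)

lemma finrank_eq (hd : 0 < d) : Module.finrank ℚ (imagQuadField d) = 2 := by
  simp [Module.finrank_eq_card_basis (basis hd)]

lemma numberField (hd : 0 < d) : NumberField (imagQuadField d) where
  to_charZero := inferInstance
  to_finiteDimensional := (basis hd).finiteDimensional_of_finite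

lemma trace_eq (hd : 0 < d) (u v : ℚ) :
    Algebra.trace ℚ (imagQuadField d) (u + v * gen d) = 2 * u := by
  have h0 : basis hd 0 = 1 := by simp [basis]
  have h1 : basis hd 1 = gen d := by simp [basis]
  have e0 : (u + v * gen d : imagQuadField d) = u • basis hd 0 + v • basis hd 1 := by
    simp [h0, h1, Rat.smul_def]
  have e1 : (u + v * gen d : imagQuadField d) * gen d
      = (-v * d) • basis hd 0 + u • basis hd 1 := by
    simp [h0, h1, Rat.smul_def]
    linear_combination (v : imagQuadField d) * gen_sq (d := d)
  rw [Algebra.trace_eq_matrix_trace (basis hd), Matrix.trace, Fin.sum_univ_two,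
    Matrix.diag_apply, Matrix.diag_apply, Algebra.leftMulMatrix_eq_repr_mul,
    Algebra.leftMulMatrix_eq_repr_mul, h0, h1, e1, mul_one, e0]
  simp
  ring

lemma not_real (hd : 0 < d) (φ : imagQuadField d →+* ℂ) : (φ (gen d)).im ≠ 0 := by
  intro h
  have h1 := congrArg φ (gen_sq (d := d))
  have h2 := congrArg Complex.re h1
  simp [pow_two, h] at h2
  have : (0 : ℝ) < d := by exact_mod_cast hd
  nlinarith [mul_self_nonneg (φ (gen d)).re]

lemma exists_int_of_isIntegral {u v : ℚ} (h : IsIntegral ℤ (u + v * gen d : imagQuadField d)) :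
    ∃ a N : ℤ, (a : ℚ) = 2 * u ∧ (N : ℚ) = u ^ 2 + d * v ^ 2 := by
  have h1 : IsIntegral ℤ ((u + v * gen d : imagQuadField d) : ℂ) :=
    h.map (imagQuadField d).subtype.toIntAlgHom
  have h2 : IsIntegral ℤ (starRingEnd ℂ ((u + v * gen d : imagQuadField d) : ℂ)) :=
    h1.map (starRingEnd ℂ).toIntAlgHom
  have key : ∀ r : ℚ, IsIntegral ℤ (r : ℂ) → ∃ a : ℤ, (a : ℚ) = r := by
    intro r hr
    have : IsIntegral ℤ r := by
      rw [← isIntegral_algebraMap_iff (B := ℂ) (algebraMap ℚ ℂ).injective]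
      simpa using hr
    exact IsIntegrallyClosed.isIntegral_iff.1 this
  have ha' : ((2 * u : ℚ) : ℂ) = ((u + v * gen d : imagQuadField d) : ℂ) +
      starRingEnd ℂ ((u + v * gen d : imagQuadField d) : ℂ) := by
    push_cast [coe_gen]
    simp
    ring
  have hN' : ((u ^ 2 + d * v ^ 2 : ℚ) : ℂ) = ((u + v * gen d : imagQuadField d) : ℂ) *
      starRingEnd ℂ ((u + v * gen d : imagQuadField d) : ℂ) := by
    rw [Complex.mul_conj, normSq_eq]
    push_cast
    rfl
  obtain ⟨a, ha⟩ := key (2 * u) (ha' ▸ h1.add h2)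
  obtain ⟨N, hN⟩ := key (u ^ 2 + d * v ^ 2) (hN' ▸ h1.mul h2)
  exact ⟨a, N, ha, hN⟩


lemma prime_le_four_mul {p s : ℕ} (hp : p.Prime) (hs : ¬ p ∣ s) {u v : ℚ} (hv : v ≠ 0) {a N : ℤ}
    (ha : (a : ℚ) = 2 * u) (hN : (N : ℚ) = u ^ 2 + (p * s : ℕ) * v ^ 2) : (p : ℤ) ≤ 4 * N := by
  have hpZ : Prime (p : ℤ) := Nat.prime_iff_prime_int.1 hp
  have hs0 : 0 < s := Nat.pos_of_ne_zero fun h ↦ hs (h ▸ dvd_zero p)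
  have hw : ((4 * N - a ^ 2 : ℤ) : ℚ) = p * s * (2 * v) ^ 2 := by
    push_cast
    rw [hN, ha]
    push_cast
    ring
  have hpos : 0 < 4 * N - a ^ 2 := by
    have : (0 : ℚ) < ((4 * N - a ^ 2 : ℤ) : ℚ) := by
      rw [hw]
      have := hp.pos
      positivity
    exact_mod_cast this
  have hdvd : (p : ℤ) ∣ 4 * N - a ^ 2 := by
    have hden : ((2 * v).den : ℚ) ≠ 0 := by exact_mod_cast (2 * v).den_nz
    have h1 : ((4 * N - a ^ 2) * ((2 * v).den : ℤ) ^ 2 : ℤ) = p * (s * (2 * v).num ^ 2) := by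
      have h2 : (2 * v) * (2 * v).den = (2 * v).num := Rat.mul_den_eq_num _
      have : (((4 * N - a ^ 2) * ((2 * v).den : ℤ) ^ 2 : ℤ) : ℚ)
          = ((p * (s * (2 * v).num ^ 2) : ℤ) : ℚ) := by
        rw [Int.cast_mul, hw]
        push_cast
        rw [← h2]
        ring
      exact_mod_cast this
    by_contra hnd
    have h3 : (p : ℤ) ∣ (2 * v).den :=
      hpZ.dvd_of_dvd_pow ((hpZ.dvd_or_dvd ⟨_, h1⟩).resolve_left hnd)
    have h4 : (p : ℤ) ∣ s * (2 * v).num ^ 2 := by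
      obtain ⟨k, hk⟩ := h3
      refine ⟨(4 * N - a ^ 2) * k ^ 2, mul_left_cancel₀ hpZ.ne_zero ?_⟩
      rw [← h1, hk]
      ring
    have h5 : (p : ℤ) ∣ (2 * v).num :=
      hpZ.dvd_of_dvd_pow ((hpZ.dvd_or_dvd h4).resolve_left (by exact_mod_cast hs))
    have h6 := Nat.dvd_gcd (Int.natCast_dvd.1 h5) (Int.natCast_dvd_natCast.1 h3)
    rw [(2 * v).reduced] at h6
    exact hp.one_lt.ne' (Nat.dvd_one.1 h6)
  have := Int.le_of_dvd hpos hdvd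
  nlinarith [sq_nonneg a]

lemma exists_int_of_ringOfIntegers (z : 𝓞 (imagQuadField d)) :
    ∃ (u v : ℚ) (a N : ℤ), (z : imagQuadField d) = u + v * gen d ∧ (a : ℚ) = 2 * u ∧
      (N : ℚ) = u ^ 2 + d * v ^ 2 ∧ Complex.normSq (z : imagQuadField d) = N := by
  obtain ⟨u, v, h⟩ := exists_eq (z : imagQuadField d)
  obtain ⟨a, N, ha, hN⟩ := exists_int_of_isIntegral (u := u) (v := v) (by
    rw [← h]
    exact z.isIntegral_coe)
  refine ⟨u, v, a, N, h, ha, hN, ?_⟩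
  rw [h, normSq_eq, ← hN]
  simp

lemma normSq_unit (ε : (𝓞 (imagQuadField d))ˣ) :
    Complex.normSq ((ε : 𝓞 (imagQuadField d)) : imagQuadField d) = 1 := by
  obtain ⟨-, -, -, N, -, -, -, hN⟩ := exists_int_of_ringOfIntegers (ε : 𝓞 (imagQuadField d))
  obtain ⟨-, -, -, M, -, -, -, hM⟩ :=
    exists_int_of_ringOfIntegers ((ε⁻¹ : (𝓞 (imagQuadField d))ˣ) : 𝓞 (imagQuadField d))
  have h : (N : ℝ) * M = 1 := by
    rw [← hN, ← hM, ← map_mul, ← MulMemClass.coe_mul, ← map_mul, ← Units.val_mul]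
    simp
  have hN0 : (0 : ℝ) ≤ N := hN ▸ Complex.normSq_nonneg _
  have h' : N * M = 1 := by exact_mod_cast h
  have hN0' : 0 ≤ N := by exact_mod_cast hN0
  rw [hN, Int.eq_one_or_neg_one_of_mul_eq_one h' |>.resolve_right (by omega)]
  simp

/-- If `x ^ 2 + d = 4 * T ^ 2`, then `(x + √-d) / 2` is an algebraic integer of norm `T ^ 2`. -/
lemma exists_root {x T : ℤ} (h : x ^ 2 + d = 4 * T ^ 2) :
    ∃ α : 𝓞 (imagQuadField d), (α : imagQuadField d) = (x / 2 : ℚ) + (1 / 2 : ℚ) * gen d ∧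
      α * (x - α) = T ^ 2 := by
  have hd : (d : imagQuadField d) = 4 * T ^ 2 - x ^ 2 := by
    have : ((x ^ 2 + d : ℤ) : imagQuadField d) = (4 * T ^ 2 : ℤ) := by rw [h]
    push_cast at this
    linear_combination this
  set y : imagQuadField d := (x / 2 : ℚ) + (1 / 2 : ℚ) * gen d with hy
  have hroot : y * (x - y) = T ^ 2 := by
    rw [hy]
    push_cast
    linear_combination (-1 / 4 : imagQuadField d) * gen_sq (d := d) + (1 / 4) * hd
  have hint : IsIntegral ℤ y := by
    refine ⟨Polynomial.X ^ 2 - Polynomial.C x * Polynomial.X + Polynomial.C (T ^ 2), ?_, ?_⟩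
    · monicity!
    · simp only [Polynomial.eval₂_add, Polynomial.eval₂_sub, Polynomial.eval₂_mul,
        Polynomial.eval₂_pow, Polynomial.eval₂_X, Polynomial.eval₂_C]
      simp only [algebraMap_int_eq, eq_intCast, Int.cast_pow]
      linear_combination -hroot
  refine ⟨⟨y, hint⟩, rfl, ?_⟩
  apply RingOfIntegers.ext
  simp only [map_intCast, map_pow]
  exact hroot

lemma exists_orderOf_eq {m : ℕ} (hm : m ≠ 0) (hmodd : Odd m) {p s t : ℕ} (hp : p.Prime)
    (hs : ¬ p ∣ s) {x : ℤ} (hx : x ^ 2 + (p * s : ℕ) = 4 * ((t ^ m : ℕ) : ℤ) ^ 2)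
    (hcop : IsCoprime x ((t ^ m : ℕ) : ℤ)) (ht : 1 < t ^ m) (hpt : 64 * (t ^ m) ^ 2 < p ^ 3)
    [NumberField (imagQuadField (p * s))] :
    ∃ g : ClassGroup (𝓞 (imagQuadField (p * s))), orderOf g = m := by
  classical
  set T : ℤ := ((t ^ m : ℕ) : ℤ) with hT
  have hT1 : 1 < T := by
    rw [hT]
    exact_mod_cast ht
  obtain ⟨α, hα, hmul⟩ := exists_root hx
  have hαN : Complex.normSq (α : imagQuadField (p * s)) = (T : ℝ) ^ 2 := by
    rw [hα, normSq_eq]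
    have : ((x ^ 2 + (p * s : ℕ) : ℤ) : ℝ) = (4 * T ^ 2 : ℤ) := by rw [hx]
    push_cast at this ⊢
    linear_combination this / 4
  have hα0 : α ≠ 0 := by
    rintro rfl
    have : (T : ℝ) = 0 := by simpa using hαN.symm
    have : T = 0 := by exact_mod_cast this
    omega
  have hcop' : IsCoprime α (x - α) := by
    obtain ⟨a, b, hab⟩ := hcop.pow_right (n := 2)
    have h : ((a * x + b * T ^ 2 : ℤ) : 𝓞 (imagQuadField (p * s))) = 1 := by rw [hab]; simp
    push_cast at h
    refine ⟨a + b * (x - α), a, ?_⟩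
    linear_combination h + b * hmul
  obtain ⟨I, hI⟩ : ∃ I : Ideal (𝓞 (imagQuadField (p * s))), Ideal.span {α} = I ^ m := by
    let _ : GCDMonoid (Ideal (𝓞 (imagQuadField (p * s)))) :=
      UniqueFactorizationMonoid.toGCDMonoid _
    refine exists_eq_pow_of_mul_eq_pow_of_coprime (b := Ideal.span {x - α})
      (c := Ideal.span {(t : 𝓞 (imagQuadField (p * s))) ^ 2})
      ((Ideal.isCoprime_span_singleton_iff _ _).2 hcop') ?_
    rw [Ideal.span_singleton_mul_span_singleton, Ideal.span_singleton_pow, hmul, hT]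
    push_cast
    rw [← pow_mul, ← pow_mul, mul_comm m]
  have hI0 : I ≠ ⊥ := by
    rintro rfl
    rw [← Ideal.zero_eq_bot, zero_pow hm, Ideal.zero_eq_bot, Ideal.span_singleton_eq_bot] at hI
    exact hα0 hI
  set J : nonZeroDivisors (Ideal (𝓞 (imagQuadField (p * s)))) :=
    ⟨I, mem_nonZeroDivisors_of_ne_zero hI0⟩ with hJ
  refine ⟨ClassGroup.mk0 J, orderOf_eq_of_pow_and_pow_div_prime (Nat.pos_of_ne_zero hm) ?_ ?_⟩
  · rw [← map_pow, ClassGroup.mk0_eq_one_iff]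
    exact ⟨⟨α, by simp [hJ, ← hI]⟩⟩
  intro q hq hqm hone
  rw [← map_pow, ClassGroup.mk0_eq_one_iff] at hone
  obtain ⟨⟨β, hβ⟩⟩ := hone
  have hq3 : 3 ≤ q := by
    have := (hmodd.of_dvd_nat hqm)
    have := hq.two_le
    rcases this.eq_or_lt with h | h
    · subst h; contradiction
    · exact h
  have hassoc : Associated (β ^ q) α := by
    rw [← Ideal.span_singleton_eq_span_singleton, hI, ← Ideal.span_singleton_pow]
    have : I ^ (m / q) = Ideal.span {β} := by simpa [hJ] using hβ
    rw [← this, ← pow_mul, Nat.div_mul_cancel hqm]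
  obtain ⟨u, v, a, N, hβe, ha, hN, hβN⟩ := exists_int_of_ringOfIntegers β
  have hNq : N ^ q = T ^ 2 := by
    obtain ⟨ε, hε⟩ := hassoc
    have := congrArg (fun z : 𝓞 (imagQuadField (p * s)) ↦
      Complex.normSq (z : imagQuadField (p * s))) hε
    simp only [map_mul, map_pow, MulMemClass.coe_mul, SubmonoidClass.coe_pow, hβN, hαN,
      normSq_unit, mul_one] at this
    exact_mod_cast this
  by_cases hv : v = 0
  · have hγ : β ∣ α := (dvd_pow_self β (by omega)).trans hassoc.dvd
    obtain ⟨γ, hγ⟩ := hγ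
    obtain ⟨u', v', a', -, hγe, ha', -⟩ := exists_int_of_ringOfIntegers γ
    have hd0 : 0 < p * s := Nat.mul_pos hp.pos (Nat.pos_of_ne_zero fun h ↦ hs (h ▸ dvd_zero p))
    have h1 : u * u' = x / 2 := by
      have h2 : (α : imagQuadField (p * s)) = β * γ := by rw [hγ]; rfl
      rw [hα, hβe, hγe, hv] at h2
      refine (eq_of_coe_eq (v := u * v') (v' := 1 / 2) hd0 ?_).1
      rw [h2]
      push_cast
      ring
    subst hv
    have h4 : a ^ 2 = 4 * N := by
      have : ((a ^ 2 : ℤ) : ℚ) = (4 * N : ℤ) := by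
        push_cast
        rw [ha, hN]
        ring
      exact_mod_cast this
    obtain ⟨n, rfl⟩ : Even a := by
      have : Even (a ^ 2) := ⟨2 * N, by omega⟩
      exact (Int.even_pow.1 this).1
    have hnx : x = n * a' := by
      have : (x : ℚ) = (n * a' : ℤ) := by
        push_cast at ha ⊢
        rw [ha', show (n : ℚ) = u by linarith]
        linarith
      exact_mod_cast this
    have hNn : N = n ^ 2 := by linarith
    have hnT : IsCoprime ((n ^ 2) ^ q) (T ^ 2) :=
      (IsCoprime.of_mul_left_left (hnx ▸ hcop)).pow_left.pow
    rw [← hNn, hNq, isCoprime_self, isUnit_pow_iff two_ne_zero] at hnT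
    rcases Int.isUnit_iff.1 hnT with h | h <;> omega
  · have hpN := prime_le_four_mul hp hs hv ha hN
    have hN1 : 1 ≤ N := by
      have := hp.pos
      omega
    have h1 : N ^ 3 ≤ T ^ 2 := hNq ▸ pow_le_pow_right₀ hN1 hq3
    have h2 : (p : ℤ) ^ 3 ≤ (4 * N) ^ 3 := pow_le_pow_left₀ (by positivity) hpN 3
    have h3 : (64 : ℤ) * T ^ 2 < p ^ 3 := by
      rw [hT]
      exact_mod_cast hpt
    nlinarith

lemma trace_ringOfIntegers (hd : 0 < d) [NumberField (imagQuadField d)]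
    {z : 𝓞 (imagQuadField d)} {u v : ℚ} (h : (z : imagQuadField d) = u + v * gen d) {a : ℤ}
    (ha : (a : ℚ) = 2 * u) : Algebra.trace ℤ (𝓞 (imagQuadField d)) z = a := by
  have h1 := Algebra.coe_trace_int z
  rw [h, trace_eq hd, ← ha] at h1
  exact_mod_cast h1

lemma abs_discr_le (hd : 0 < d) [NumberField (imagQuadField d)] {x T : ℤ}
    (h : x ^ 2 + d = 4 * T ^ 2) : |NumberField.discr (imagQuadField d)| ≤ d := by
  obtain ⟨α, hα, hmul⟩ := exists_root h
  let b := Module.finBasisOfFinrankEq ℤ (𝓞 (imagQuadField d))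
    ((RingOfIntegers.rank _).trans (finrank_eq hd))
  let w : Fin 2 → 𝓞 (imagQuadField d) := ![1, α]
  have hw : Algebra.discr ℤ w = -d := by
    have h1 : Algebra.trace ℤ (𝓞 (imagQuadField d)) 1 = 2 :=
      trace_ringOfIntegers hd (u := 1) (v := 0) (by simp) (by norm_num)
    have h2 : Algebra.trace ℤ (𝓞 (imagQuadField d)) α = x :=
      trace_ringOfIntegers hd hα (by ring)
    have h3 : Algebra.trace ℤ (𝓞 (imagQuadField d)) (α * α) = x * x - T ^ 2 * 2 := by
      have : α * α = x • α - (T ^ 2) • (1 : 𝓞 (imagQuadField d)) := by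
        simp
        linear_combination -hmul
      rw [this, map_sub, map_smul, map_smul, h1, h2]
      rfl
    rw [Algebra.discr_def, Matrix.det_fin_two]
    simp only [Algebra.traceMatrix_apply, Algebra.traceForm_apply, w, Matrix.cons_val_zero,
      Matrix.cons_val_one, one_mul, mul_one, h1, h2, h3]
    linarith
  have hdvd : NumberField.discr (imagQuadField d) ∣ (d : ℤ) := by
    have h4 := Algebra.discr_of_matrix_vecMul b (b.toMatrix w)
    rw [Module.Basis.toMatrix_map_vecMul, hw, NumberField.discr_eq_discr] at h4
    exact (dvd_neg.1 ⟨_, h4.trans (mul_comm _ _)⟩)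
  exact Int.le_of_dvd (by exact_mod_cast hd) ((abs_dvd _ _).2 hdvd)

/-- A prime dividing `d` exactly once divides `d'` whenever `√-d` lies in `ℚ(√-d')`. -/
lemma prime_dvd_of_ringHom {p s d' : ℕ} (hp : p.Prime) (hs : ¬ p ∣ s) (hd' : 0 < d')
    (φ : imagQuadField (p * s) →+* imagQuadField d') : p ∣ d' := by
  have hpZ : Prime (p : ℤ) := Nat.prime_iff_prime_int.1 hp
  have hs0 : 0 < s := Nat.pos_of_ne_zero fun h ↦ hs (h ▸ dvd_zero p)
  have h := congrArg φ (gen_sq (d := p * s))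
  obtain ⟨u, v, huv⟩ := exists_eq (φ (gen (p * s)))
  rw [map_pow, huv, map_neg, map_natCast] at h
  have h1 : ((u ^ 2 - d' * v ^ 2 : ℚ) + (2 * u * v : ℚ) * gen d' : imagQuadField d') =
      (-(p * s : ℕ) : ℚ) + (0 : ℚ) * gen d' := by
    push_cast at h ⊢
    linear_combination h - (v : imagQuadField d') ^ 2 * gen_sq (d := d')
  obtain ⟨h2, h3⟩ := eq_of_coe_eq hd' h1
  push_cast at h2
  have hpos : (0 : ℚ) < p * s := by exact_mod_cast Nat.mul_pos hp.pos hs0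
  have hv : v ≠ 0 := by
    rintro rfl
    nlinarith [sq_nonneg u]
  have hu : u = 0 := by simpa [hv] using h3
  rw [hu] at h2
  have hint : ((p * s : ℕ) : ℤ) * (v.den : ℤ) ^ 2 = d' * v.num ^ 2 := by
    have h4 : v * v.den = v.num := Rat.mul_den_eq_num _
    have : ((((p * s : ℕ) : ℤ) * (v.den : ℤ) ^ 2 : ℤ) : ℚ) = ((d' * v.num ^ 2 : ℤ) : ℚ) := by
      push_cast
      rw [← h4]
      linear_combination (v.den : ℚ) ^ 2 * h2
    exact_mod_cast this
  push_cast at hint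
  by_contra hnd
  have h5 : (p : ℤ) ∣ v.num := hpZ.dvd_of_dvd_pow ((hpZ.dvd_or_dvd
    ⟨s * (v.den : ℤ) ^ 2, by rw [← hint]; ring⟩).resolve_left (by exact_mod_cast hnd))
  have h6 : (p : ℤ) ∣ s * (v.den : ℤ) ^ 2 := by
    obtain ⟨k, hk⟩ := h5
    refine ⟨d' * k ^ 2, mul_left_cancel₀ hpZ.ne_zero ?_⟩
    rw [← mul_assoc, hint, hk]
    ring
  have h7 : (p : ℤ) ∣ v.den :=
    hpZ.dvd_of_dvd_pow ((hpZ.dvd_or_dvd h6).resolve_left (by exact_mod_cast hs))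
  have h8 := Nat.dvd_gcd (Int.natCast_dvd.1 h5) (Int.natCast_dvd_natCast.1 h7)
  rw [v.reduced] at h8
  exact hp.one_lt.ne' (Nat.dvd_one.1 h8)

end imagQuadField

lemma not_dvd_four_mul_sub {m t p : ℕ} (hm : 3 ≤ m) (hp : p.Prime) (ht : 1 < t ^ m)
    (hpt : 64 * (t ^ m) ^ 2 < p ^ 3) (hpT : p < 2 * t ^ m) :
    ¬ p ∣ t ^ m ∧ ¬ p ∣ 4 * t ^ m - p := by
  have h1 : ¬ p ∣ t ^ m := by
    intro h
    have ht0 : 0 < t := Nat.pos_of_ne_zero fun h ↦ by subst h; simp [show m ≠ 0 by omega] at ht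
    have h2 : p ≤ t := Nat.le_of_dvd ht0 (hp.dvd_of_dvd_pow h)
    have h3 : p ^ 3 ≤ t ^ m := (Nat.pow_le_pow_left h2 3).trans (Nat.pow_le_pow_right ht0 hm)
    nlinarith
  refine ⟨h1, fun h ↦ ?_⟩
  have h2 : p ∣ 4 * t ^ m := by
    have := Nat.dvd_add h (dvd_refl p)
    rwa [Nat.sub_add_cancel (by omega)] at this
  have h3 : p ∣ 2 ^ 2 := (hp.dvd_mul.1 h2).resolve_right h1
  have h4 : p ≤ 2 := Nat.le_of_dvd two_pos (hp.dvd_of_dvd_pow h3)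
  have h5 : p ^ 3 ≤ 2 ^ 3 := Nat.pow_le_pow_left h4 3
  nlinarith

lemma eq_of_dvd_of_dvd {T p q : ℕ} (hp : p.Prime) (hq : q.Prime) (hT : 1 < T)
    (hp1 : 64 * T ^ 2 < p ^ 3) (hq1 : 64 * T ^ 2 < q ^ 3) (hp2 : p < 2 * T) (hq2 : q < 2 * T)
    (hpq : p ∣ q * (4 * T - q)) (hqp : q ∣ p * (4 * T - p)) : p = q := by
  by_contra hne
  have hpq' := (hp.dvd_mul.1 hpq).resolve_left fun h ↦ hne ((Nat.prime_dvd_prime_iff_eq hp hq).1 h)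
  have hqp' := (hq.dvd_mul.1 hqp).resolve_left
    fun h ↦ hne ((Nat.prime_dvd_prime_iff_eq hq hp).1 h).symm
  have hdvd : p * q ∣ 4 * T - p - q := by
    refine Nat.Coprime.mul_dvd_of_dvd_of_dvd ((Nat.coprime_primes hp hq).2 hne) ?_ ?_
    · rw [show 4 * T - p - q = 4 * T - q - p by omega]
      exact Nat.dvd_sub hpq' (dvd_refl p)
    · exact Nat.dvd_sub hqp' (dvd_refl q)
  have hle := Nat.le_of_dvd (by omega) hdvd
  have h1 : p * q ≤ 4 * T := by omega
  have h2 : (p * q) ^ 3 ≤ (4 * T) ^ 3 := Nat.pow_le_pow_left h1 3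
  have h3 : (64 * T ^ 2) * (64 * T ^ 2) < p ^ 3 * q ^ 3 := Nat.mul_lt_mul'' hp1 hq1
  have h4 : T ^ 3 ≤ T ^ 4 := Nat.pow_le_pow_right (by omega) (by omega)
  nlinarith

open Filter in
/-- A crude form of Chebyshev's lower bound on primes that are not too small. -/
lemma eventually_le_card_primes : ∀ᶠ T : ℕ in atTop, (T : ℝ) ^ (2 / 3 : ℝ) ≤
    ((Finset.range (2 * T)).filter fun p ↦ p.Prime ∧ 64 * T ^ 2 < p ^ 3).card := by
  have hlog : ∀ᶠ y : ℝ in atTop, Real.log y ≤ (1 / 100) * y ^ (1 / 3 : ℝ) := by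
    have := (isLittleO_log_rpow_atTop (r := 1 / 3) (by norm_num)).bound
      (show (0 : ℝ) < 1 / 100 by norm_num)
    filter_upwards [this, eventually_ge_atTop 1] with y hy hy1
    rwa [Real.norm_of_nonneg (Real.log_nonneg hy1), Real.norm_of_nonneg (by positivity)] at hy
  have hlog' : ∀ᶠ T : ℕ in atTop, Real.log ((3 * T : ℕ) : ℝ) ≤
      (1 / 100) * ((3 * T : ℕ) : ℝ) ^ (1 / 3 : ℝ) :=
    (tendsto_natCast_atTop_atTop.comp
      (tendsto_id.const_mul_atTop' (show 0 < 3 by norm_num))).eventually hlog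
  filter_upwards [hlog', eventually_ge_atTop 2] with T hT hT2
  set z : ℝ := (T : ℝ) ^ (1 / 3 : ℝ) with hz
  have hT0 : (0 : ℝ) ≤ T := Nat.cast_nonneg T
  have hz1 : 1 ≤ z := Real.one_le_rpow (by exact_mod_cast (by omega : 1 ≤ T)) (by norm_num)
  have hz2 : (T : ℝ) ^ (2 / 3 : ℝ) = z ^ 2 := by
    rw [hz, ← Real.rpow_natCast, ← Real.rpow_mul hT0]
    norm_num
  have hz3 : (T : ℝ) = z ^ 3 := by
    rw [hz, ← Real.rpow_natCast, ← Real.rpow_mul hT0]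
    norm_num
  have hl : Real.log ((3 * T : ℕ) : ℝ) ≤ z / 50 := by
    have h3 : (3 : ℝ) ^ (1 / 3 : ℝ) ≤ 2 := by
      calc (3 : ℝ) ^ (1 / 3 : ℝ) ≤ 8 ^ (1 / 3 : ℝ) :=
            Real.rpow_le_rpow (by norm_num) (by norm_num) (by norm_num)
        _ = 2 := by
            rw [show (8 : ℝ) = 2 ^ (3 : ℝ) by norm_num, ← Real.rpow_mul (by norm_num)]
            norm_num
    push_cast at hT ⊢
    rw [Real.mul_rpow (by norm_num) hT0, ← hz] at hT
    nlinarith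
  have hpi := Chebyshev.pi_ge (2 * T)
  have hcast : (2 : ℝ) ≤ T := by exact_mod_cast hT2
  have hlogpos : 0 < Real.log ((2 * T : ℕ) : ℝ) := by
    apply Real.log_pos
    push_cast
    linarith
  have hl1 : Real.log ((2 * T : ℕ) : ℝ) ≤ z / 50 := by
    refine (Real.log_le_log ?_ ?_).trans hl
    · push_cast; linarith
    · push_cast; linarith
  have hl2 : Real.log ((2 * T : ℕ) + 1 : ℝ) ≤ z / 50 := by
    refine (Real.log_le_log ?_ ?_).trans hl
    · push_cast; linarith
    · push_cast; linarith
  have hpi' : 6 * z ^ 2 ≤ Nat.primeCounting (2 * T) := by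
    refine le_trans ?_ hpi
    rw [le_div_iff₀ hlogpos]
    have h1 : 6 * z ^ 2 * Real.log ((2 * T : ℕ) : ℝ) ≤ 6 * z ^ 2 * (z / 50) :=
      mul_le_mul_of_nonneg_left hl1 (by positivity)
    have h2 := Real.log_two_gt_d9
    have h3 : ((2 * T : ℕ) : ℝ) * (1 / 2) ≤ ((2 * T : ℕ) : ℝ) * Real.log 2 :=
      mul_le_mul_of_nonneg_left (by linarith) (Nat.cast_nonneg _)
    push_cast at h1 h3 hl2 ⊢
    rw [hz3] at h1 h3 hl2 ⊢
    nlinarith [pow_le_pow_right₀ hz1 (show 1 ≤ 3 by norm_num)]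
  have hsub : (Finset.range (2 * T + 1)).filter Nat.Prime ⊆
      ((Finset.range (2 * T)).filter fun p ↦ p.Prime ∧ 64 * T ^ 2 < p ^ 3) ∪
        Finset.range (⌊4 * z ^ 2⌋₊ + 1) := by
    intro p hp
    rw [Finset.mem_filter, Finset.mem_range] at hp
    rw [Finset.mem_union, Finset.mem_filter, Finset.mem_range, Finset.mem_range]
    by_cases h : 64 * T ^ 2 < p ^ 3
    · left
      refine ⟨lt_of_le_of_ne (by omega) ?_, hp.2, h⟩
      rintro rfl
      exact Nat.not_prime_mul (by norm_num) (by omega) hp.2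
    · right
      rw [Nat.lt_succ_iff]
      apply Nat.le_floor
      have h' : ((p ^ 3 : ℕ) : ℝ) ≤ (64 * T ^ 2 : ℕ) := by exact_mod_cast not_lt.1 h
      push_cast at h'
      rw [hz3] at h'
      refine le_of_pow_le_pow_left₀ three_ne_zero (by positivity) (h'.trans_eq ?_)
      ring
  have hcard := (Finset.card_le_card hsub).trans (Finset.card_union_le _ _)
  rw [Finset.card_range] at hcard
  have hpc : Nat.primeCounting (2 * T) = ((Finset.range (2 * T + 1)).filter Nat.Prime).card := by
    rw [Nat.primeCounting, Nat.primeCounting', Nat.count_eq_card_filter_range]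
  rw [hpc] at hpi'
  have hcardR : ((((Finset.range (2 * T + 1)).filter Nat.Prime).card : ℕ) : ℝ) ≤
      (((Finset.range (2 * T)).filter fun p ↦ p.Prime ∧ 64 * T ^ 2 < p ^ 3).card : ℝ) +
        ((⌊4 * z ^ 2⌋₊ : ℝ) + 1) := by exact_mod_cast hcard
  have hfl : (⌊4 * z ^ 2⌋₊ : ℝ) ≤ 4 * z ^ 2 := Nat.floor_le (by positivity)
  rw [hz2]
  nlinarith

open Filter in
lemma eventually_exists_pow {m : ℕ} (hm : 3 ≤ m) {P : ℕ → Prop} (hP : ∀ᶠ T in atTop, P T) :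
    ∀ᶠ X : ℝ in atTop, ∃ t : ℕ, P (t ^ m) ∧ 1 < t ^ m ∧ 4 * ((t ^ m : ℕ) : ℝ) ^ 2 ≤ X ∧
      ((4 : ℝ) ^ (m + 1)) ^ (-(1 / 3) : ℝ) * X ^ ((1 : ℝ) / m) / Real.log X ≤
        ((t ^ m : ℕ) : ℝ) ^ (2 / 3 : ℝ) := by
  have hm0 : m ≠ 0 := by omega
  have ht : Tendsto (fun X : ℝ ↦ ⌊(X / 4) ^ (((2 * m : ℕ) : ℝ)⁻¹)⌋₊) atTop atTop :=
    tendsto_nat_floor_atTop.comp ((tendsto_rpow_atTop (by positivity)).comp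
      (tendsto_id.atTop_div_const (by norm_num)))
  have hT := (tendsto_pow_atTop (α := ℕ) hm0).comp ht
  filter_upwards [hT.eventually hP, hT.eventually (eventually_gt_atTop 1),
    eventually_ge_atTop (Real.exp 1)] with X hPX hX1 hXe
  have hX0 : 0 < X := (Real.exp_pos 1).trans_le hXe
  have hXone : 1 ≤ X := (Real.one_le_exp zero_le_one).trans hXe
  have hlog : 1 ≤ Real.log X := (Real.le_log_iff_exp_le hX0).2 hXe
  simp only [Function.comp_apply] at hPX hX1
  set r : ℝ := (X / 4) ^ (((2 * m : ℕ) : ℝ)⁻¹) with hr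
  have hr0 : 0 ≤ r := by positivity
  have hrX : r ^ (2 * m) = X / 4 := Real.rpow_inv_natCast_pow (by positivity) (by omega)
  set t : ℕ := ⌊r⌋₊ with htdef
  have ht1 : 1 ≤ t := by
    rw [Nat.one_le_iff_ne_zero]
    rintro h
    rw [h, zero_pow hm0] at hX1
    omega
  have ht1R : (1 : ℝ) ≤ t := by exact_mod_cast ht1
  refine ⟨t, hPX, hX1, ?_, ?_⟩
  · have h1 : (t : ℝ) ^ (2 * m) ≤ r ^ (2 * m) :=
      pow_le_pow_left₀ (Nat.cast_nonneg _) (Nat.floor_le hr0) _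
    push_cast
    rw [← pow_mul, mul_comm m 2]
    linarith
  · have h1 : r ^ (2 * m) ≤ (2 * t : ℝ) ^ (2 * m) :=
      pow_le_pow_left₀ hr0 (by linarith [Nat.lt_floor_add_one r]) _
    have h2 : X ≤ (4 : ℝ) ^ (m + 1) * ((t ^ m : ℕ) : ℝ) ^ 2 := by
      rw [hrX, mul_pow, pow_mul (2 : ℝ), mul_comm 2 m, pow_mul (t : ℝ)] at h1
      push_cast
      norm_num at h1
      rw [pow_succ]
      linarith
    have h3 : X ^ ((1 : ℝ) / m) ≤ X ^ ((1 : ℝ) / 3) :=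
      Real.rpow_le_rpow_of_exponent_le hXone
        (one_div_le_one_div_of_le (by norm_num) (by exact_mod_cast hm))
    have h4 : X ^ ((1 : ℝ) / 3) ≤
        ((4 : ℝ) ^ (m + 1)) ^ ((1 : ℝ) / 3) * ((t ^ m : ℕ) : ℝ) ^ (2 / 3 : ℝ) := by
      refine (Real.rpow_le_rpow hX0.le h2 (by norm_num)).trans_eq ?_
      rw [Real.mul_rpow (by positivity) (by positivity), ← Real.rpow_natCast (_ : ℝ) 2,
        ← Real.rpow_mul (by positivity)]
      norm_num
    calc ((4 : ℝ) ^ (m + 1)) ^ (-(1 / 3) : ℝ) * X ^ ((1 : ℝ) / m) / Real.log X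
        ≤ ((4 : ℝ) ^ (m + 1)) ^ (-(1 / 3) : ℝ) * X ^ ((1 : ℝ) / m) :=
          div_le_self (by positivity) hlog
      _ ≤ ((4 : ℝ) ^ (m + 1)) ^ (-(1 / 3) : ℝ) *
          (((4 : ℝ) ^ (m + 1)) ^ ((1 : ℝ) / 3) * ((t ^ m : ℕ) : ℝ) ^ (2 / 3 : ℝ)) :=
          mul_le_mul_of_nonneg_left (h3.trans h4) (by positivity)
      _ = ((t ^ m : ℕ) : ℝ) ^ (2 / 3 : ℝ) := by
          rw [← mul_assoc, ← Real.rpow_add (by positivity)]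
          simp

lemma exists_zmod_hom_injective {G : Type*} [CommGroup G] {m : ℕ} {g : G} (hg : orderOf g = m) :
    ∃ f : ZMod m →+ Additive G, Function.Injective f := by
  subst hg
  refine ⟨ZMod.lift _ ⟨zmultiplesHom _ (Additive.ofMul g), ?_⟩, (ZMod.lift_injective _).2 ?_⟩
  · simp [← ofMul_pow, pow_orderOf_eq_one]
  · intro k hk
    rw [ZMod.intCast_zmod_eq_zero_iff_dvd, orderOf_dvd_iff_zpow_eq_one]
    simpa [← ofMul_zpow] using hk

/-- Let `m ≥ 3` be an odd integer. There is a constant `c > 0` such that for all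
sufficiently large `X`, the number of isomorphism classes of imaginary quadratic fields `k` with
`|Disc(k)| < X` and `rank_m Cl(k) ≥ 1` is at least `c·X^(1/m)/log X`. -/
theorem quantitative_toy_example (m : ℕ) (hm : 3 ≤ m) (hmodd : Odd m) :
    ∃ c : ℝ, 0 < c ∧ ∃ X₀ : ℝ, ∀ X : ℝ, X₀ ≤ X →
      ∃ S : Finset (Subfield ℂ),
        -- the fields in `S` are pairwise non-isomorphic
        (∀ K ∈ S, ∀ L ∈ S, Nonempty (↥K ≃+* ↥L) → K = L) ∧
        (∀ K ∈ S,
          -- `K` is an imaginary quadratic field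
          Module.finrank ℚ ↥K = 2 ∧
          (∀ φ : ↥K →+* ℂ, ∃ a : ↥K, (φ a).im ≠ 0) ∧
          NumberField ↥K ∧
          (∀ [NumberField ↥K],
            -- `|Disc K| < X`
            |(NumberField.discr ↥K : ℝ)| < X ∧
            -- `rank_m Cl(K) ≥ 1`
            ∃ f : ZMod m →+ Additive (ClassGroup (𝓞 ↥K)), Function.Injective f)) ∧
        c * X ^ ((1 : ℝ) / m) / Real.log X ≤ S.card := by
  have hm0 : m ≠ 0 := by omega
  refine ⟨((4 : ℝ) ^ (m + 1)) ^ (-(1 / 3) : ℝ), by positivity, Filter.eventually_atTop.1 ?_⟩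
  filter_upwards [eventually_exists_pow hm eventually_le_card_primes] with X hX
  obtain ⟨t, hcard, ht, hTX, hle⟩ := hX
  set A := (Finset.range (2 * t ^ m)).filter fun p ↦ p.Prime ∧ 64 * (t ^ m) ^ 2 < p ^ 3
  have hA : ∀ p ∈ A, p < 2 * t ^ m ∧ p.Prime ∧ 64 * (t ^ m) ^ 2 < p ^ 3 := fun p hp ↦ by
    simpa [A] using hp
  have hpos : ∀ p ∈ A, 0 < p * (4 * t ^ m - p) := fun p hp ↦
    Nat.mul_pos (hA p hp).2.1.pos (by have := (hA p hp).1; omega)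
  have key : ∀ p ∈ A, ∀ q ∈ A, Nonempty (imagQuadField (p * (4 * t ^ m - p)) ≃+*
      imagQuadField (q * (4 * t ^ m - q))) → p = q := by
    rintro p hpA q hqA ⟨e⟩
    obtain ⟨hp1, hp2, hp3⟩ := hA p hpA
    obtain ⟨hq1, hq2, hq3⟩ := hA q hqA
    exact eq_of_dvd_of_dvd hp2 hq2 ht hp3 hq3 hp1 hq1
      (imagQuadField.prime_dvd_of_ringHom hp2 (not_dvd_four_mul_sub hm hp2 ht hp3 hp1).2
        (hpos q hqA) e.toRingHom)
      (imagQuadField.prime_dvd_of_ringHom hq2 (not_dvd_four_mul_sub hm hq2 ht hq3 hq1).2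
        (hpos p hpA) e.symm.toRingHom)
  classical
  refine ⟨A.image fun p ↦ imagQuadField (p * (4 * t ^ m - p)), ?_, ?_, ?_⟩
  · intro K hK L hL hKL
    obtain ⟨p, hp, rfl⟩ := Finset.mem_image.1 hK
    obtain ⟨q, hq, rfl⟩ := Finset.mem_image.1 hL
    rw [key p hp q hq hKL]
  · intro K hK
    obtain ⟨p, hpA, rfl⟩ := Finset.mem_image.1 hK
    obtain ⟨hpT, hp, hp3⟩ := hA p hpA
    obtain ⟨hpt, hps⟩ := not_dvd_four_mul_sub hm hp ht hp3 hpT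
    have hx : (2 * ((t ^ m : ℕ) : ℤ) - p) ^ 2 + (p * (4 * t ^ m - p) : ℕ) =
        4 * ((t ^ m : ℕ) : ℤ) ^ 2 := by
      rw [Nat.cast_mul, Nat.cast_sub (by omega)]
      push_cast
      ring
    refine ⟨imagQuadField.finrank_eq (hpos p hpA),
      fun φ ↦ ⟨_, imagQuadField.not_real (hpos p hpA) φ⟩,
      imagQuadField.numberField (hpos p hpA), ?_⟩
    intro _
    constructor
    · have h1 := imagQuadField.abs_discr_le (hpos p hpA) hx
      have h2 : |NumberField.discr (imagQuadField (p * (4 * t ^ m - p)))| <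
          4 * ((t ^ m : ℕ) : ℤ) ^ 2 := by
        have : (0 : ℤ) < (2 * ((t ^ m : ℕ) : ℤ) - p) ^ 2 := by
          have : (0 : ℤ) < 2 * ((t ^ m : ℕ) : ℤ) - p := by
            have : (p : ℤ) < 2 * ((t ^ m : ℕ) : ℤ) := by exact_mod_cast hpT
            linarith
          positivity
        linarith
      refine lt_of_lt_of_le ?_ hTX
      exact_mod_cast h2
    · have hcop : IsCoprime (2 * ((t ^ m : ℕ) : ℤ) - p) ((t ^ m : ℕ) : ℤ) := by
        have h : IsCoprime (p : ℤ) ((t ^ m : ℕ) : ℤ) :=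
          Nat.isCoprime_iff_coprime.2 ((Nat.Prime.coprime_iff_not_dvd hp).2 hpt)
        have := h.neg_left.add_mul_right_left 2
        rwa [neg_add_eq_sub] at this
      obtain ⟨g, hg⟩ := imagQuadField.exists_orderOf_eq hm0 hmodd hp hps hx hcop ht hp3
      exact exists_zmod_hom_injective hg
  · rw [Finset.card_image_of_injOn]
    · exact hle.trans hcard
    · intro p hp q hq h
      exact key p hp q hq ⟨RingEquiv.subringCongr (congrArg Subfield.toSubring h)⟩
end

section
/- Let m ≥ 3 be an odd integer and let x ≥ 3 be an odd integer. Let k = ℚ(√(1−x^m)) and let y = √(1−x^m), which is an element of the ring of integers O_k. Then the principal ideals (1−y)O_k and (1+y)O_k are coprime, and there exists an ideal 𝔞 of O_k such that (1−y)O_k = 𝔞^m. In particular, the class of 𝔞 in the ideal class group Cl(k) has order dividing m. -/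
open NumberField

/-- Let `m ≥ 3` be an odd integer and let `x ≥ 3` be an odd integer. Let
`k = ℚ(√(1−x^m))` and let `y = √(1−x^m) ∈ O_k`. Then the principal ideals `(1−y)O_k` and
`(1+y)O_k` are coprime, and there exists an ideal `𝔞` of `O_k` with `(1−y)O_k = 𝔞^m`;
in particular the class of `𝔞` in `Cl(k)` has order dividing `m`. -/
theorem toy_example_ideal_power (m x : ℕ) (hm : 3 ≤ m) (hmodd : Odd m)
    (hx : 3 ≤ x) (hxodd : Odd x)
    (z : ℂ) (hz : z ^ 2 = 1 - (x : ℂ) ^ m)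
    (K : IntermediateField ℚ ℂ) (hK : K = IntermediateField.adjoin ℚ {z})
    (y : 𝓞 ↥K) (hy : ((y : ↥K) : ℂ) = z) :
    IsCoprime (Ideal.span {1 - y} : Ideal (𝓞 ↥K)) (Ideal.span {1 + y}) ∧
    ∃ a : Ideal (𝓞 ↥K), Ideal.span {1 - y} = a ^ m ∧
      ∀ [NumberField ↥K], ∀ ha : a ≠ 0,
        ClassGroup.mk0 ⟨a, mem_nonZeroDivisors_of_ne_zero ha⟩ ^ m = 1 := by
  have hprod : (1 - y) * (1 + y) = (x : 𝓞 ↥K) ^ m := by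
    apply RingOfIntegers.ext
    apply Subtype.ext
    push_cast
    rw [hy]
    linear_combination -hz
  have hzint : IsIntegral ℚ z := by
    rw [← hy]
    exact (IsIntegral.tower_top (A := ℚ) y.isIntegral_coe).map K.val
  have hfin : FiniteDimensional ℚ ↥K := by
    rw [hK]
    exact IntermediateField.adjoin.finiteDimensional hzint
  have hnf : NumberField ↥K := { to_charZero := inferInstance, to_finiteDimensional := hfin }
  have hcop : IsCoprime (1 - y) (1 + y) := by
    obtain ⟨t, ht⟩ := hxodd.pow (n := m)
    have ht' : (x : 𝓞 ↥K) ^ m = 2 * t + 1 := by exact_mod_cast congrArg (Nat.cast (R := 𝓞 ↥K)) ht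
    -- The two elements sum to `2`, while their product `x ^ m` is odd.
    refine ⟨1 + y - t, -t, ?_⟩
    linear_combination hprod + ht'
  have hcop' : IsCoprime (Ideal.span {1 - y} : Ideal (𝓞 ↥K)) (Ideal.span {1 + y}) :=
    (Ideal.isCoprime_span_singleton_iff _ _).mpr hcop
  obtain ⟨a, ha⟩ := exists_eq_pow_of_mul_eq_pow_of_coprime hcop'
    (show _ = (Ideal.span {(x : 𝓞 ↥K)}) ^ m by
      rw [Ideal.span_singleton_mul_span_singleton, hprod, Ideal.span_singleton_pow])
  refine ⟨hcop', a, ha, fun {_} ha0 => ?_⟩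
  rw [← map_pow, ClassGroup.mk0_eq_one_iff]
  exact ⟨1 - y, ha.symm⟩
end

section
/- Let m > 1 be an integer. There is a constant c > 0 such that for all sufficiently large X, the number of isomorphism classes of imaginary quadratic fields k with |Disc(k)| < X and rank_m Cl(k) ≥ 2 is at least c·X^(1/(2m−1))/log X. -/
open NumberField

/-- The subfield `ℚ(√-d)` of `ℂ`. -/
noncomputable def imagQuad (d : ℕ) : Subfield ℂ where
  carrier := {x | ∃ a b : ℚ, x = a + b * (√d * Complex.I)}
  mul_mem' := by
    rintro _ _ ⟨a, b, rfl⟩ ⟨a', b', rfl⟩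
    refine ⟨a * a' - b * b' * d, a * b' + a' * b, ?_⟩
    have h : ((√d : ℝ) : ℂ) ^ 2 = d := by
      rw [← Complex.ofReal_pow, Real.sq_sqrt (Nat.cast_nonneg d)]; simp
    push_cast
    linear_combination (b * b' * (√d : ℝ) ^ 2 : ℂ) * Complex.I_sq - (b * b' : ℂ) * h
  one_mem' := ⟨1, 0, by simp⟩
  add_mem' := by
    rintro _ _ ⟨a, b, rfl⟩ ⟨a', b', rfl⟩
    exact ⟨a + a', b + b', by push_cast; ring⟩
  zero_mem' := ⟨0, 0, by simp⟩
  neg_mem' := by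
    rintro _ ⟨a, b, rfl⟩
    exact ⟨-a, -b, by push_cast; ring⟩
  inv_mem' := by
    rintro _ ⟨a, b, rfl⟩
    have h : ((√d : ℝ) : ℂ) ^ 2 = d := by
      rw [← Complex.ofReal_pow, Real.sq_sqrt (Nat.cast_nonneg d)]; simp
    by_cases h0 : (a + b * (√d * Complex.I) : ℂ) = 0
    · exact ⟨0, 0, by simp [h0]⟩
    have h1 : (a - b * (√d * Complex.I) : ℂ) ≠ 0 := by
      intro h1
      apply h0
      have := congrArg (starRingEnd ℂ) h1
      simpa using this
    have h2 : (a ^ 2 + b ^ 2 * d : ℂ) = (a + b * (√d * Complex.I)) * (a - b * (√d * Complex.I)) := by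
      linear_combination (b ^ 2 * (√d : ℝ) ^ 2 : ℂ) * Complex.I_sq - (b ^ 2 : ℂ) * h
    have h3 : (a ^ 2 + b ^ 2 * d : ℂ) ≠ 0 := by rw [h2]; exact mul_ne_zero h0 h1
    refine ⟨a / (a ^ 2 + b ^ 2 * d), -b / (a ^ 2 + b ^ 2 * d), ?_⟩
    rw [inv_eq_of_mul_eq_one_right]
    push_cast
    field_simp
    rw [h2]
    ring

namespace imagQuad

variable {d : ℕ}

theorem mem_iff {x : ℂ} : x ∈ imagQuad d ↔ ∃ a b : ℚ, x = a + b * (√d * Complex.I) := Iff.rfl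

/-- The square root of `-d` in `imagQuad d`. -/
noncomputable def root (d : ℕ) : imagQuad d := ⟨√d * Complex.I, 0, 1, by simp⟩

theorem root_sq : root d ^ 2 = -(d : imagQuad d) := by
  ext
  have h : ((√d : ℝ) : ℂ) ^ 2 = d := by
    rw [← Complex.ofReal_pow, Real.sq_sqrt (Nat.cast_nonneg d)]; simp
  simp [root, mul_pow, h]

theorem exists_eq (x : imagQuad d) : ∃ a b : ℚ, x = a + b * root d := by
  obtain ⟨a, b, h⟩ := mem_iff.1 x.2
  exact ⟨a, b, by ext; simpa [root] using h⟩

/-- The coordinates of `imagQuad d` with respect to `1` and `root d`. -/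
noncomputable def linearEquiv (hd : 0 < d) : (ℚ × ℚ) ≃ₗ[ℚ] imagQuad d :=
  LinearEquiv.ofBijective
    ((LinearMap.toSpanSingleton ℚ (imagQuad d) 1).coprod
      (LinearMap.toSpanSingleton ℚ (imagQuad d) (root d))) <| by
    constructor
    · rw [← LinearMap.ker_eq_bot, LinearMap.ker_eq_bot']
      rintro ⟨a, b⟩ h
      have h' := congrArg (Subtype.val) h
      simp [root, Rat.smul_def] at h'
      have hs : √(d : ℝ) ≠ 0 := by positivity
      have h1 := congrArg Complex.re h'
      have h2 := congrArg Complex.im h'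
      simp [hs] at h1 h2
      simp [h1, h2]
    · intro x
      obtain ⟨a, b, rfl⟩ := exists_eq x
      exact ⟨(a, b), by simp [Rat.smul_def]⟩

theorem finrank_eq_two (hd : 0 < d) : Module.finrank ℚ (imagQuad d) = 2 := by
  rw [← (linearEquiv hd).finrank_eq]; simp

theorem numberField (hd : 0 < d) : NumberField (imagQuad d) where
  to_charZero := inferInstance
  to_finiteDimensional := Module.finite_of_finrank_pos (by rw [finrank_eq_two hd]; norm_num)

theorem exists_im_ne_zero (hd : 0 < d) (φ : imagQuad d →+* ℂ) : ∃ a, (φ a).im ≠ 0 := by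
  refine ⟨root d, fun h => ?_⟩
  have h1 : φ (root d) ^ 2 = -d := by rw [← map_pow, root_sq]; simp
  have h2 := congrArg Complex.re h1
  simp [pow_two, h] at h2
  have : (0 : ℝ) < d := by exact_mod_cast hd
  nlinarith [mul_self_nonneg (φ (root d)).re]

theorem le_of_ringHom {d' : ℕ} (ψ : imagQuad d →+* imagQuad d') : imagQuad d ≤ imagQuad d' := by
  have h1 : ((ψ (root d) : imagQuad d') : ℂ) ^ 2 = (root d : ℂ) ^ 2 := by
    have h1 : ψ (root d) ^ 2 = -d := by rw [← map_pow, root_sq]; simp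
    have h2 : (root d : ℂ) ^ 2 = -d := by
      have := congrArg Subtype.val (root_sq (d := d)); simpa using this
    rw [h2]
    have := congrArg Subtype.val h1; simpa using this
  have hmem : (root d : ℂ) ∈ imagQuad d' := by
    rcases sq_eq_sq_iff_eq_or_eq_neg.1 h1 with h | h
    · rw [← h]; exact (ψ (root d)).2
    · rw [← neg_eq_iff_eq_neg.2 h]; exact neg_mem (ψ (root d)).2
  intro x hx
  obtain ⟨a, b, h⟩ := mem_iff.1 hx
  rw [h]
  refine add_mem ?_ (mul_mem ?_ hmem)
  · exact SubfieldClass.ratCast_mem _ a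
  · exact SubfieldClass.ratCast_mem _ b

theorem eq_of_ringEquiv {d' : ℕ} (h : Nonempty (imagQuad d ≃+* imagQuad d')) :
    imagQuad d = imagQuad d' :=
  h.elim fun ψ => le_antisymm (le_of_ringHom ψ.toRingHom) (le_of_ringHom ψ.symm.toRingHom)

theorem exists_mul_eq_sq {d' : ℕ} (hd : 0 < d) (h : imagQuad d = imagQuad d') :
    ∃ y : ℕ, d * d' = y ^ 2 := by
  have hmem : (root d : ℂ) ∈ imagQuad d' := h ▸ (root d).2
  obtain ⟨a, b, hab⟩ := mem_iff.1 hmem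
  have hs : √(d : ℝ) ≠ 0 := by positivity
  have h2 := congrArg Complex.im hab
  simp [root] at h2
  have h3 : (d : ℝ) = b ^ 2 * d' := by
    rw [← Real.sq_sqrt (Nat.cast_nonneg d), h2, mul_pow, Real.sq_sqrt (Nat.cast_nonneg d')]
  have h4 : ((d * d' : ℕ) : ℚ) = (b * d') ^ 2 := by
    have : (d : ℚ) = b ^ 2 * d' := by exact_mod_cast h3
    push_cast; rw [this]; ring
  have h5 : IsSquare ((d * d' : ℕ) : ℚ) := ⟨b * d', by rw [h4]; ring⟩
  rw [Rat.isSquare_natCast_iff] at h5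
  obtain ⟨y, hy⟩ := h5
  exact ⟨y, by rw [hy]; ring⟩

theorem exists_intCast_of_isIntegral {q : ℚ} (h : IsIntegral ℤ (q : ℂ)) : ∃ n : ℤ, (n : ℚ) = q := by
  have h' : IsIntegral ℤ q := by
    rw [← isIntegral_algebraMap_iff (A := ℚ) (B := ℂ) (algebraMap ℚ ℂ).injective]
    simpa using h
  simpa using IsIntegrallyClosed.isIntegral_iff.1 h'

theorem isIntegral_coe (x : 𝓞 (imagQuad d)) : IsIntegral ℤ ((x : imagQuad d) : ℂ) :=
  (map_isIntegral_int (imagQuad d).subtype x.isIntegral_coe)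

theorem exists_int_trace (x : 𝓞 (imagQuad d)) {a b : ℚ} (h : (x : imagQuad d) = a + b * root d) :
    ∃ t : ℤ, (t : ℚ) = 2 * a := by
  apply exists_intCast_of_isIntegral
  have h1 := isIntegral_coe x
  have h2 := h1.add (map_isIntegral_int (starRingEnd ℂ) h1)
  have h3 : ((2 * a : ℚ) : ℂ) = (x : imagQuad d) + starRingEnd ℂ (x : imagQuad d) := by
    rw [h]
    simp [root]
    ring
  rw [h3]
  exact h2

theorem isIntegral_root : IsIntegral ℤ (root d) := by
  refine ⟨Polynomial.X ^ 2 + Polynomial.C (d : ℤ), by monicity!, ?_⟩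
  simp [root_sq]

/-- The square root of `-d` in the ring of integers of `imagQuad d`. -/
noncomputable def intRoot (d : ℕ) : 𝓞 (imagQuad d) := ⟨root d, isIntegral_root⟩

theorem coe_intRoot : ((intRoot d : 𝓞 (imagQuad d)) : imagQuad d) = root d := rfl

theorem intRoot_sq : intRoot d ^ 2 = -(d : 𝓞 (imagQuad d)) := by
  apply RingOfIntegers.coe_injective
  simp [coe_intRoot, root_sq]

theorem exists_two_mul_eq (x : 𝓞 (imagQuad d)) :
    ∃ t t' : ℤ, 2 * d * x = d * t + t' * intRoot d := by
  obtain ⟨a, b, h⟩ := exists_eq (x : imagQuad d)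
  obtain ⟨t, ht⟩ := exists_int_trace x h
  obtain ⟨t', ht'⟩ := exists_int_trace (a := - b * d) (b := a) (x * intRoot d) (by
    rw [show ((x * intRoot d : 𝓞 (imagQuad d)) : imagQuad d) = x * root d from rfl, h]
    push_cast
    linear_combination (b : imagQuad d) * root_sq (d := d))
  refine ⟨t, -t', RingOfIntegers.coe_injective ?_⟩
  have ht1 : (t : imagQuad d) = 2 * a := by exact_mod_cast congrArg (Rat.cast (K := imagQuad d)) ht
  have ht2 : (t' : imagQuad d) = 2 * (-b * d) := by
    exact_mod_cast congrArg (Rat.cast (K := imagQuad d)) ht'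
  simp only [map_mul, map_add, map_natCast, map_intCast, map_ofNat, coe_intRoot, h]
  push_cast
  rw [ht1, ht2]
  ring

theorem exists_int_norm (x : 𝓞 (imagQuad d)) :
    ∃ n : ℤ, (n : ℝ) = Complex.normSq (x : imagQuad d) := by
  obtain ⟨a, b, h⟩ := exists_eq (x : imagQuad d)
  have hn : ((a ^ 2 + b ^ 2 * d : ℚ) : ℝ) = Complex.normSq (x : imagQuad d) := by
    rw [h, Complex.normSq_apply]
    simp [root]
    have := Real.sq_sqrt (Nat.cast_nonneg (α := ℝ) d)
    linear_combination (-b ^ 2 : ℝ) * this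
  obtain ⟨n, hn'⟩ := exists_intCast_of_isIntegral (q := a ^ 2 + b ^ 2 * d) (by
    have h1 := isIntegral_coe x
    have h2 := h1.mul (map_isIntegral_int (starRingEnd ℂ) h1)
    rw [Complex.mul_conj, ← hn] at h2
    simpa using h2)
  exact ⟨n, by rw [← hn, ← hn']; simp⟩

theorem unit_pow_twelve (ε : (𝓞 (imagQuad d))ˣ) : (ε : 𝓞 (imagQuad d)) ^ 12 = 1 := by
  obtain ⟨n, hn⟩ := exists_int_norm (ε : 𝓞 (imagQuad d))
  obtain ⟨n', hn'⟩ := exists_int_norm ((ε⁻¹ : (𝓞 (imagQuad d))ˣ) : 𝓞 (imagQuad d))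
  have hnn : n * n' = 1 := by
    have : (n * n' : ℝ) = 1 := by
      rw [hn, hn', ← map_mul]
      have := congrArg (fun x : 𝓞 (imagQuad d) => ((x : imagQuad d) : ℂ)) ε.mul_inv
      simp only [map_mul, map_one] at this
      rw [← Subfield.coe_mul, this]
      simp
    exact_mod_cast this
  have hn0 : 0 ≤ n := by
    have := Complex.normSq_nonneg ((ε : 𝓞 (imagQuad d)) : imagQuad d)
    rw [← hn] at this
    exact_mod_cast this
  have hn1 : n = 1 := by
    rcases Int.eq_one_or_neg_one_of_mul_eq_one hnn with h | h <;> omega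
  obtain ⟨a, b, h⟩ := exists_eq ((ε : 𝓞 (imagQuad d)) : imagQuad d)
  obtain ⟨t, ht⟩ := exists_int_trace _ h
  set z : ℂ := (((ε : 𝓞 (imagQuad d)) : imagQuad d) : ℂ) with hz
  have hre : (t : ℝ) = 2 * z.re := by
    rw [hz, h]
    have : (t : ℝ) = 2 * a := by exact_mod_cast congrArg (Rat.cast (K := ℝ)) ht
    simp [root, this]
  rw [hn1, Complex.normSq_apply] at hn
  have hzt : z ^ 2 - t * z + 1 = 0 := by
    have hre' : (t : ℂ) = 2 * z.re := by exact_mod_cast congrArg Complex.ofReal hre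
    rw [hre']
    apply Complex.ext
    · simp [pow_two]; push_cast at hn; linarith
    · simp [pow_two]; ring
  have ht4 : t ^ 2 ≤ 4 := by
    have : (t : ℝ) ^ 2 ≤ 4 := by
      rw [hre]; push_cast at hn; nlinarith [mul_self_nonneg z.im]
    exact_mod_cast this
  have ht2 : -2 ≤ t ∧ t ≤ 2 := ⟨by nlinarith, by nlinarith⟩
  have key : z ^ 12 = 1 := by
    obtain ⟨h1, h2⟩ := ht2
    interval_cases t
    · have : z = -1 := by
        have : (z + 1) ^ 2 = 0 := by push_cast at hzt; linear_combination hzt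
        exact eq_neg_of_add_eq_zero_left (pow_eq_zero_iff two_ne_zero |>.1 this)
      rw [this]; norm_num
    · have : z ^ 3 = 1 := by push_cast at hzt; linear_combination (z - 1) * hzt
      rw [show (12 : ℕ) = 3 * 4 by rfl, pow_mul, this]; norm_num
    · have : z ^ 2 = -1 := by push_cast at hzt; linear_combination hzt
      rw [show (12 : ℕ) = 2 * 6 by rfl, pow_mul, this]; norm_num
    · have : z ^ 3 = -1 := by push_cast at hzt; linear_combination (z + 1) * hzt
      rw [show (12 : ℕ) = 3 * 4 by rfl, pow_mul, this]; norm_num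
    · have : z = 1 := by
        have : (z - 1) ^ 2 = 0 := by push_cast at hzt; linear_combination hzt
        exact sub_eq_zero.1 (pow_eq_zero_iff two_ne_zero |>.1 this)
      rw [this]; norm_num
  apply RingOfIntegers.coe_injective
  apply Subtype.val_injective
  simpa using key

/-- A prime `l` not dividing `2 * d` at which `-d` is a square splits in `imagQuad d`. -/
theorem exists_ringHom_zmod {l : ℕ} [Fact l.Prime] (h2 : (2 * d : ZMod l) ≠ 0) {r : ZMod l}
    (hr : (-d : ZMod l) = r ^ 2) : Nonempty (𝓞 (imagQuad d) →+* ZMod l) := by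
  have hl : ¬ IsUnit (l : 𝓞 (imagQuad d)) := by
    rintro ⟨ε, hε⟩
    obtain ⟨n, hn⟩ := exists_int_norm ((ε⁻¹ : (𝓞 (imagQuad d))ˣ) : 𝓞 (imagQuad d))
    have h1 : (l : ℝ) ^ 2 * n = 1 := by
      rw [hn]
      have := congrArg (fun x : 𝓞 (imagQuad d) => ((x : imagQuad d) : ℂ)) ε.mul_inv
      rw [hε] at this
      simp only [map_mul, map_one, map_natCast, Subfield.coe_mul] at this
      have := congrArg Complex.normSq this
      simpa [Complex.normSq_natCast, pow_two] using this
    have h3 : (l : ℤ) ^ 2 * n = 1 := by exact_mod_cast h1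
    have h4 : IsUnit (l : ℤ) := IsUnit.of_mul_eq_one (l * n) (by linear_combination h3)
    have := (Fact.out : l.Prime).one_lt
    rw [Int.isUnit_iff] at h4
    omega
  obtain ⟨P, hP, hlP⟩ := exists_max_ideal_of_mem_nonunits hl
  let R := 𝓞 (imagQuad d) ⧸ P
  let _ : Field R := Ideal.Quotient.field P
  have hchar : CharP R l := by
    refine (CharP.charP_iff_prime_eq_zero (R := R) Fact.out).2 ?_
    have := (Ideal.Quotient.eq_zero_iff_mem (I := P)).2 hlP
    simpa using this
  let f : ZMod l →+* R := ZMod.castHom dvd_rfl R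
  have hf : Function.Bijective f := by
    refine ⟨f.injective, fun y => ?_⟩
    obtain ⟨x, rfl⟩ := Ideal.Quotient.mk_surjective y
    obtain ⟨t, t', h⟩ := exists_two_mul_eq x
    have hroot : ∃ c : ZMod l, f c = Ideal.Quotient.mk P (intRoot d) := by
      have h1 : (f r) ^ 2 = (Ideal.Quotient.mk P (intRoot d)) ^ 2 := by
        rw [← map_pow, ← map_pow, intRoot_sq, ← hr]; simp
      rcases sq_eq_sq_iff_eq_or_eq_neg.1 h1 with h | h
      · exact ⟨r, h⟩
      · exact ⟨-r, by rw [map_neg, h, neg_neg]⟩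
    obtain ⟨c, hc⟩ := hroot
    refine ⟨(2 * d : ZMod l)⁻¹ * (d * t + t' * c), ?_⟩
    have h3 : f (2 * d) ≠ 0 := by rwa [Ne, map_eq_zero]
    rw [map_mul, map_inv₀, inv_mul_eq_iff_eq_mul₀ h3]
    have := congrArg (Ideal.Quotient.mk P) h
    simp only [map_mul, map_add, map_natCast, map_intCast, map_ofNat] at this ⊢
    rw [hc, this]
  exact ⟨(RingEquiv.ofBijective f hf).symm.toRingHom.comp (Ideal.Quotient.mk P)⟩

end imagQuad

theorem Ideal.exists_span_singleton_eq_pow {R : Type*} [CommRing R] [IsDedekindDomain R]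
    {a b c : R} {n : ℕ} (hab : IsCoprime a b) (h : a * b = c ^ n) :
    ∃ I : Ideal R, Ideal.span {a} = I ^ n := by
  refine exists_eq_pow_of_mul_eq_pow_of_coprime (b := Ideal.span {b}) (c := Ideal.span {c})
    (Ideal.isCoprime_span_singleton_iff a b |>.2 hab) ?_
  rw [Ideal.span_singleton_mul_span_singleton, h, Ideal.span_singleton_pow]

theorem exists_injective_zmod_sq {G : Type*} [CommGroup G] {m : ℕ} [NeZero m] {g h : G}
    (hg : g ^ m = 1) (hh : h ^ m = 1) (H : ∀ i j : ℕ, g ^ i * h ^ j = 1 → m ∣ i ∧ m ∣ j) :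
    ∃ f : (Fin 2 → ZMod m) →+ Additive G, Function.Injective f := by
  let A : Additive G := Additive.ofMul g
  let B : Additive G := Additive.ofMul h
  have hA : (zmultiplesHom (Additive G) A) m = 0 := by
    simp only [zmultiplesHom_apply, natCast_zsmul]; exact hg
  have hB : (zmultiplesHom (Additive G) B) m = 0 := by
    simp only [zmultiplesHom_apply, natCast_zsmul]; exact hh
  let fA := ZMod.lift m ⟨_, hA⟩
  let fB := ZMod.lift m ⟨_, hB⟩
  refine ⟨fA.comp (Pi.evalAddMonoidHom (fun _ : Fin 2 => ZMod m) 0) +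
    fB.comp (Pi.evalAddMonoidHom (fun _ : Fin 2 => ZMod m) 1), ?_⟩
  rw [injective_iff_map_eq_zero]
  intro x hx
  obtain ⟨i, hi⟩ := ZMod.natCast_zmod_surjective (x 0)
  obtain ⟨j, hj⟩ := ZMod.natCast_zmod_surjective (x 1)
  have hfA : fA (x 0) = i • A := by
    rw [← hi, ← Int.cast_natCast, ZMod.lift_coe]; simp
  have hfB : fB (x 1) = j • B := by
    rw [← hj, ← Int.cast_natCast, ZMod.lift_coe]; simp
  have h0 : i • A + j • B = 0 := by rw [← hfA, ← hfB]; exact hx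
  obtain ⟨h1, h2⟩ := H i j h0
  ext k
  fin_cases k
  · simpa [← hi, ZMod.natCast_eq_zero_iff] using h1
  · simpa [← hj, ZMod.natCast_eq_zero_iff] using h2

theorem ZMod.dvd_of_pow_mul_eq {l m h : ℕ} [Fact l.Prime] (hl : l - 1 = m * (12 * h))
    {g : (ZMod l)ˣ} (hg : orderOf g = l - 1) {y η t : ZMod l} (hη : η ^ 12 = 1) (ht : t ≠ 0) {i : ℕ}
    (H : y ^ m * η = g ^ i * t ^ m) : m ∣ i := by
  have hp := (Fact.out : l.Prime).one_lt
  have hpos : 0 < m * (12 * h) := by omega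
  have hm0 : m ≠ 0 := by rintro rfl; simp at hpos
  have hh0 : 0 < 12 * h := Nat.pos_of_mul_pos_left hpos
  have hy : y ≠ 0 := by
    rintro rfl
    rw [zero_pow hm0, zero_mul] at H
    exact mul_ne_zero (pow_ne_zero _ g.ne_zero) (pow_ne_zero _ ht) H.symm
  have H2 := congrArg (fun x => x ^ (12 * h)) H
  simp only [mul_pow, ← pow_mul] at H2
  rw [← hl, ZMod.pow_card_sub_one_eq_one hy, ZMod.pow_card_sub_one_eq_one ht, pow_mul η, hη,
    one_pow, mul_one, mul_one] at H2
  have H3 : g ^ (i * (12 * h)) = 1 := by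
    ext; simpa using H2.symm
  have H4 := orderOf_dvd_of_pow_eq_one H3
  rw [hg, hl] at H4
  exact Nat.dvd_of_mul_dvd_mul_right hh0 H4

namespace imagQuad

theorem exists_ringHom_generator {s e F l : ℕ} [Fact l.Prime] (hl : 3 < l)
    {ρ : (ZMod l)ˣ} (hρ : orderOf ρ = l - 1) (hs : (s : ZMod l) ^ 4 = 1)
    (hu : (s ^ 2 * F + e : ZMod l) ^ 2 = 1) (h : (2 * (s ^ 2 * F - e) : ZMod l) = ρ + (ρ : ZMod l)⁻¹) :
    ∃ φ : 𝓞 (imagQuad (e * F)) →+* ZMod l, ∃ g : (ZMod l)ˣ, orderOf g = l - 1 ∧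
      φ (s ^ 2 * F - e + 2 * s * intRoot (e * F)) = g := by
  have h2 : (2 : ZMod l) ≠ 0 := by
    intro h0
    have : ((2 : ℕ) : ZMod l) = 0 := by exact_mod_cast h0
    rw [ZMod.natCast_eq_zero_iff] at this
    have := Nat.le_of_dvd two_pos this
    omega
  have hρ0 : (ρ : ZMod l) ≠ 0 := ρ.ne_zero
  have hρ2 : (ρ : ZMod l) ^ 2 ≠ 1 := by
    intro h0
    have h1 : ρ ^ 2 = 1 := by ext; simpa using h0
    have := Nat.le_of_dvd two_pos (orderOf_dvd_of_pow_eq_one h1)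
    omega
  have hρρ : (ρ : ZMod l) * (ρ : ZMod l)⁻¹ = 1 := mul_inv_cancel₀ hρ0
  have hne : (ρ : ZMod l) - (ρ : ZMod l)⁻¹ ≠ 0 := by
    intro h0
    apply hρ2
    linear_combination (ρ : ZMod l) * h0 + hρρ
  have h16 : (-(16 * s ^ 2 * (e * F)) : ZMod l) = ((ρ : ZMod l) - (ρ : ZMod l)⁻¹) ^ 2 := by
    linear_combination (2 * (s ^ 2 * F - e) + (ρ + (ρ : ZMod l)⁻¹) : ZMod l) * h - 4 * hu + 4 * hρρ
  have hd0 : (2 * (e * F : ℕ) : ZMod l) ≠ 0 := by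
    rw [Nat.cast_mul]
    intro h0
    apply hne
    rw [← sq_eq_zero_iff, ← h16]
    linear_combination (-8 * s ^ 2 : ZMod l) * h0
  have hr : (-(e * F : ℕ) : ZMod l) = (s * ((ρ : ZMod l) - (ρ : ZMod l)⁻¹) * (4 : ZMod l)⁻¹) ^ 2 := by
    have h4 : (4 : ZMod l) ≠ 0 := by
      rw [show (4 : ZMod l) = 2 * 2 by norm_num]; exact mul_ne_zero h2 h2
    rw [← div_eq_mul_inv, div_pow, eq_div_iff (pow_ne_zero _ h4), mul_pow, ← h16]
    push_cast
    linear_combination (16 * e * F : ZMod l) * hs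
  obtain ⟨φ⟩ := exists_ringHom_zmod hd0 hr
  set α : 𝓞 (imagQuad (e * F)) := s ^ 2 * F - e + 2 * s * intRoot (e * F) with hα
  have hsq : φ (intRoot (e * F)) ^ 2 = -(e * F : ZMod l) := by
    rw [← map_pow, intRoot_sq]; simp
  have hφα : φ α = s ^ 2 * F - e + 2 * s * φ (intRoot (e * F)) := by
    simp only [hα, map_add, map_mul, map_sub, map_natCast, map_pow, map_ofNat]
  have hroot : (φ α - ρ) * (φ α - (ρ : ZMod l)⁻¹) = 0 := by
    rw [hφα]
    linear_combination (-(s ^ 2 * F - e + 2 * s * φ (intRoot (e * F))) : ZMod l) * (-h) + hρρ - hu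
      + (4 * s ^ 2 : ZMod l) * hsq
  refine ⟨φ, ?_⟩
  rcases mul_eq_zero.1 hroot with h0 | h0
  · exact ⟨ρ, hρ, sub_eq_zero.1 h0⟩
  · exact ⟨ρ⁻¹, by rw [orderOf_inv, hρ], by rw [sub_eq_zero.1 h0, Units.val_inv_eq_inv_val]⟩

theorem isCoprime_of_add_of_mul {R : Type*} [CommRing R] {a b c t : R} {n : ℕ} (hmul : a * b = c ^ n)
    (hadd : a + b = t) (h : IsCoprime c t) : IsCoprime a b := by
  have h1 : IsCoprime (a * b) t := by rw [hmul]; exact h.pow_left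
  rw [← hadd] at h1
  obtain ⟨x, y, hxy⟩ := h1
  exact ⟨x * b + y, y, by linear_combination hxy⟩

theorem exists_injective_classGroup {m s e F u v τ l₁ l₂ : ℕ} [Fact l₁.Prime] [Fact l₂.Prime]
    (hm : 1 < m)
    (hu : s ^ 2 * F + e = u ^ m) (hv : F + s ^ 2 * e = v ^ m)
    (hc₁ : IsCoprime (u : ℤ) (2 * (s ^ 2 * F - e)))
    (hc₂ : IsCoprime (u * v : ℤ) (2 * s * (F - e)))
    (hl₁ : 12 * m ∣ l₁ - 1) (hl₂ : 12 * m ∣ l₂ - 1)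
    {ρ₁ : (ZMod l₁)ˣ} (hρ₁ : orderOf ρ₁ = l₁ - 1) {ρ₂ : (ZMod l₂)ˣ} (hρ₂ : orderOf ρ₂ = l₂ - 1)
    (hτ : (s : ZMod l₁) = τ ^ m) (hs₁ : (s : ZMod l₁) ^ 2 = -1) (hs₂ : (s : ZMod l₂) = 1)
    (h₁ : (F - e : ZMod l₁) = 1) (h₁' : (2 * (-F - e) : ZMod l₁) = ρ₁ + (ρ₁ : ZMod l₁)⁻¹)
    (h₂ : (F + e : ZMod l₂) = 1) (h₂' : (2 * (F - e) : ZMod l₂) = ρ₂ + (ρ₂ : ZMod l₂)⁻¹)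
    [NumberField (imagQuad (e * F))] :
    ∃ f : (Fin 2 → ZMod m) →+ Additive (ClassGroup (𝓞 (imagQuad (e * F)))),
      Function.Injective f := by
  have : NeZero m := ⟨by omega⟩
  have hlt : ∀ l : ℕ, l.Prime → 12 * m ∣ l - 1 → 3 < l := by
    intro l hl hd
    have := hl.one_lt
    have := Nat.le_of_dvd (by omega) hd
    omega
  obtain ⟨φ₁, g₁, hg₁, hφ₁⟩ := exists_ringHom_generator (s := s) (e := e) (F := F)
    (hlt _ Fact.out hl₁) hρ₁ (by linear_combination ((s : ZMod l₁) ^ 2 - 1) * hs₁)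
    (by rw [hs₁]; linear_combination (F - e + 1 : ZMod l₁) * h₁) (by rw [hs₁, ← h₁']; ring)
  obtain ⟨φ₂, g₂, hg₂, hφ₂⟩ := exists_ringHom_generator (s := s) (e := e) (F := F)
    (hlt _ Fact.out hl₂) hρ₂ (by rw [hs₂]; ring)
    (by rw [hs₂]; linear_combination (F + e + 1 : ZMod l₂) * h₂) (by rw [hs₂, ← h₂']; ring)
  let O := 𝓞 (imagQuad (e * F))
  set r : O := intRoot (e * F) with hr
  have hr2 : r ^ 2 = -(e * F : O) := by rw [hr, intRoot_sq]; push_cast; ring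
  have huO : (s ^ 2 * F + e : O) = u ^ m := by exact_mod_cast congrArg (Nat.cast (R := O)) hu
  have hvO : (F + s ^ 2 * e : O) = v ^ m := by exact_mod_cast congrArg (Nat.cast (R := O)) hv
  set α : O := s ^ 2 * F - e + 2 * s * r with hα
  set β : O := s * (F - e) + (s ^ 2 + 1) * r with hβ
  have hαα : α * (s ^ 2 * F - e - 2 * s * r) = ((u : O) ^ 2) ^ m := by
    rw [pow_right_comm, ← huO, hα]
    linear_combination (-4 * s ^ 2 : O) * hr2
  have hββ : β * (s * (F - e) - (s ^ 2 + 1) * r) = (u * v : O) ^ m := by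
    rw [mul_pow, ← huO, ← hvO, hβ]
    linear_combination (-(s ^ 2 + 1) ^ 2 : O) * hr2
  have hcα : IsCoprime α (s ^ 2 * F - e - 2 * s * r) := by
    refine isCoprime_of_add_of_mul hαα (t := 2 * (s ^ 2 * F - e)) (by rw [hα]; ring) ?_
    have := hc₁.map (Int.castRingHom O)
    exact IsCoprime.pow_left (by simpa using this)
  have hcβ : IsCoprime β (s * (F - e) - (s ^ 2 + 1) * r) := by
    refine isCoprime_of_add_of_mul hββ (t := 2 * s * (F - e)) (by rw [hβ]; ring) ?_
    have := hc₂.map (Int.castRingHom O)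
    simpa using this
  obtain ⟨A, hA⟩ := Ideal.exists_span_singleton_eq_pow hcα hαα
  obtain ⟨B, hB⟩ := Ideal.exists_span_singleton_eq_pow hcβ hββ
  have hφβ₁ : φ₁ β = τ ^ m := by
    rw [← hτ, hβ]
    simp only [map_add, map_mul, map_sub, map_natCast, map_pow, map_one]
    linear_combination (s : ZMod l₁) * h₁ + φ₁ r * hs₁
  have hφβ₂ : φ₂ β = g₂ := by
    rw [← hφ₂, hβ, hα]
    simp only [map_add, map_mul, map_sub, map_natCast, map_pow, map_one, map_ofNat, hs₂]
    ring
  have hα0 : α ≠ 0 := by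
    intro h; rw [h, map_zero] at hφ₁; exact g₁.ne_zero hφ₁.symm
  have hβ0 : β ≠ 0 := by
    intro h; rw [h, map_zero] at hφβ₂; exact g₂.ne_zero hφβ₂.symm
  have hτ0 : (τ : ZMod l₁) ≠ 0 := by
    intro h
    rw [hτ, h, zero_pow (by omega)] at hs₁
    norm_num at hs₁
  have hA0 : A ≠ 0 := by
    rintro rfl
    rw [zero_pow (by omega), Ideal.zero_eq_bot, Ideal.span_singleton_eq_bot] at hA
    exact hα0 hA
  have hB0 : B ≠ 0 := by
    rintro rfl
    rw [zero_pow (by omega), Ideal.zero_eq_bot, Ideal.span_singleton_eq_bot] at hB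
    exact hβ0 hB
  let A' : nonZeroDivisors (Ideal O) := ⟨A, mem_nonZeroDivisors_of_ne_zero hA0⟩
  let B' : nonZeroDivisors (Ideal O) := ⟨B, mem_nonZeroDivisors_of_ne_zero hB0⟩
  refine exists_injective_zmod_sq (g := ClassGroup.mk0 A') (h := ClassGroup.mk0 B') ?_ ?_ ?_
  · rw [← map_pow, ClassGroup.mk0_eq_one_iff]
    exact ⟨⟨α, by simpa [A'] using hA.symm⟩⟩
  · rw [← map_pow, ClassGroup.mk0_eq_one_iff]
    exact ⟨⟨β, by simpa [B'] using hB.symm⟩⟩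
  intro i j hij
  rw [← map_pow, ← map_pow, ← map_mul, ClassGroup.mk0_eq_one_iff] at hij
  obtain ⟨⟨x, hx⟩⟩ := hij
  have hx' : A ^ i * B ^ j = Ideal.span {x} := by simpa [A', B'] using hx
  have hspan : Ideal.span {x ^ m} = Ideal.span {α ^ i * β ^ j} := by
    rw [← Ideal.span_singleton_pow, ← hx', ← Ideal.span_singleton_mul_span_singleton,
      ← Ideal.span_singleton_pow, ← Ideal.span_singleton_pow, hA, hB, mul_pow]
    simp only [← pow_mul, mul_comm]
  obtain ⟨ε, hε⟩ := Ideal.span_singleton_eq_span_singleton.1 hspan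
  have hε12 := unit_pow_twelve ε
  obtain ⟨k₁, hk₁⟩ := hl₁
  obtain ⟨k₂, hk₂⟩ := hl₂
  have hi : m ∣ i := by
    refine ZMod.dvd_of_pow_mul_eq (h := k₁) (by rw [hk₁]; ring) hg₁ (y := φ₁ x) (η := φ₁ ε)
      (t := τ ^ j) (by rw [← map_pow, hε12, map_one]) (pow_ne_zero _ hτ0) ?_
    rw [← map_pow, ← map_mul, hε, map_mul, map_pow, map_pow, hφ₁, hφβ₁, ← pow_mul, ← pow_mul,
      mul_comm m j]
  have hij : m ∣ i + j := by
    refine ZMod.dvd_of_pow_mul_eq (h := k₂) (by rw [hk₂]; ring) hg₂ (y := φ₂ x) (η := φ₂ ε)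
      (t := 1) (by rw [← map_pow, hε12, map_one]) one_ne_zero ?_
    rw [← map_pow, ← map_mul, hε, map_mul, map_pow, map_pow, hφ₂, hφβ₂, one_pow, mul_one, pow_add]
  exact ⟨hi, (Nat.dvd_add_right hi).1 hij⟩

end imagQuad

namespace imagQuad

variable {d : ℕ}

theorem linearEquiv_apply (hd : 0 < d) (p : ℚ × ℚ) :
    linearEquiv hd p = p.1 + p.2 * root d := by
  change p.1 • (1 : imagQuad d) + p.2 • root d = _
  simp [Rat.smul_def]

theorem trace_root (hd : 0 < d) : Algebra.trace ℚ (imagQuad d) (root d) = 0 := by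
  let c : Module.Basis (Fin 2) ℚ (imagQuad d) :=
    (Module.Basis.finTwoProd ℚ).map (linearEquiv hd)
  have h0 : c 0 = 1 := by simp [c, linearEquiv_apply]
  have h1 : c 1 = root d := by simp [c, linearEquiv_apply]
  rw [Algebra.trace_eq_matrix_trace c, Matrix.trace_fin_two, Algebra.leftMulMatrix_eq_repr_mul,
    Algebra.leftMulMatrix_eq_repr_mul]
  have h2 : root d * c 0 = c 1 := by rw [h0, h1, mul_one]
  have h3 : root d * c 1 = (-d : ℚ) • c 0 := by
    rw [h0, h1, ← pow_two, root_sq, Rat.smul_def]; simp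
  rw [h2, h3, map_smul]
  simp

theorem abs_discr_le (hd : 0 < d) [NumberField (imagQuad d)] :
    |discr (imagQuad d)| ≤ 4 * d := by
  let b : Module.Basis (Fin 2) ℤ (𝓞 (imagQuad d)) := Module.finBasisOfFinrankEq ℤ _ (by
    rw [RingOfIntegers.rank, finrank_eq_two hd])
  let w : Fin 2 → 𝓞 (imagQuad d) := ![1, intRoot d]
  have ht0 : Algebra.trace ℤ _ (1 : 𝓞 (imagQuad d)) = 2 := by
    have := Algebra.coe_trace_int (1 : 𝓞 (imagQuad d))
    rw [show ((1 : 𝓞 (imagQuad d)) : imagQuad d) = algebraMap ℚ _ 1 by simp, Algebra.trace_algebraMap,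
      finrank_eq_two hd] at this
    have h2 : ((Algebra.trace ℤ _ (1 : 𝓞 (imagQuad d)) : ℤ) : ℚ) = 2 := by simpa using this
    exact_mod_cast h2
  have ht1 : Algebra.trace ℤ _ (intRoot d) = 0 := by
    have := Algebra.coe_trace_int (intRoot d)
    rw [coe_intRoot, trace_root hd] at this
    exact_mod_cast this
  have ht2 : Algebra.trace ℤ _ (intRoot d * intRoot d) = -2 * d := by
    rw [← pow_two, intRoot_sq, show (-(d : 𝓞 (imagQuad d))) = (-d : ℤ) • 1 by simp, map_smul, ht0]
    simp; ring
  have hw : Algebra.discr ℤ w = -4 * d := by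
    rw [Algebra.discr_def, Matrix.det_fin_two]
    simp only [Algebra.traceMatrix_apply, Algebra.traceForm_apply, w]
    simp only [Matrix.cons_val_zero, Matrix.cons_val_one, one_mul, mul_one, ht0, ht1, ht2]
    ring
  have hP : w = Matrix.vecMul b ((b.toMatrix w).map (algebraMap ℤ (𝓞 (imagQuad d)))) := by
    ext1 j
    rw [← b.sum_toMatrix_smul_self w j]
    simp [Matrix.vecMul, dotProduct, mul_comm]
  rw [hP, Algebra.discr_of_matrix_vecMul, discr_eq_discr] at hw
  have h0 : (b.toMatrix w).det ≠ 0 := by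
    intro h
    rw [h] at hw
    simp at hw
    omega
  have h1 : 1 ≤ (b.toMatrix w).det ^ 2 := by
    have := sq_pos_of_ne_zero h0
    omega
  have h2 : (b.toMatrix w).det ^ 2 * |discr (imagQuad d)| = 4 * d := by
    rw [← abs_of_nonneg (sq_nonneg (b.toMatrix w).det), ← abs_mul, hw]
    simp
  nlinarith [abs_nonneg (discr (imagQuad d))]

end imagQuad

theorem exists_nat_zmod_eq {l₁ l₂ N : ℕ} [NeZero l₁] [NeZero l₂] (h₁₂ : l₁.Coprime l₂)
    (hN : N.Coprime (l₁ * l₂)) (a : ZMod l₁) (b : ZMod l₂) (c : ℕ) :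
    ∃ n : ℕ, (n : ZMod l₁) = a ∧ (n : ZMod l₂) = b ∧ n ≡ c [MOD N] := by
  obtain ⟨x, hx₁, hx₂⟩ := Nat.chineseRemainder h₁₂ a.val b.val
  obtain ⟨n, hn₁, hn₂⟩ := Nat.chineseRemainder hN c x
  refine ⟨n, ?_, ?_, hn₁⟩
  · have := (ZMod.natCast_eq_natCast_iff _ _ _).2 ((hn₂.of_mul_right l₂).trans hx₁)
    rwa [ZMod.natCast_zmod_val] at this
  · have := (ZMod.natCast_eq_natCast_iff _ _ _).2 ((hn₂.of_mul_left l₁).trans hx₂)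
    rwa [ZMod.natCast_zmod_val] at this

theorem ZMod.exists_orderOf_eq_sub_one (l : ℕ) [Fact l.Prime] :
    ∃ ρ : (ZMod l)ˣ, orderOf ρ = l - 1 := by
  obtain ⟨ρ, hρ⟩ := IsCyclic.exists_ofOrder_eq_natCard (α := (ZMod l)ˣ)
  exact ⟨ρ, by rw [hρ, Nat.card_eq_fintype_card, ZMod.card_units]⟩

theorem ZMod.exists_pow_two_mul_eq_neg_one {l m : ℕ} [Fact l.Prime] (hl : 12 * m ∣ l - 1) :
    ∃ τ : ZMod l, τ ^ (2 * m) = -1 := by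
  obtain ⟨ρ, hρ⟩ := ZMod.exists_orderOf_eq_sub_one l
  obtain ⟨k, hk⟩ := hl
  have hp := (Fact.out : l.Prime).one_lt
  have h1 : ρ ^ (6 * m * k) ≠ 1 := by
    intro h
    have h2 := orderOf_dvd_of_pow_eq_one h
    rw [hρ] at h2
    rcases Nat.eq_zero_or_pos (m * k) with h0 | h0
    · rw [mul_assoc, h0] at hk; omega
    · have := Nat.le_of_dvd (by rw [mul_assoc]; omega) h2
      rw [hk, mul_assoc, mul_assoc] at this
      omega
  have h2 : ρ ^ (12 * m * k) = 1 := by rw [← hk, ← hρ, pow_orderOf_eq_one]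
  refine ⟨((ρ ^ (3 * k) : (ZMod l)ˣ) : ZMod l), ?_⟩
  rw [← Units.val_pow_eq_pow_val, ← pow_mul, show 3 * k * (2 * m) = 6 * m * k by ring]
  have h3 : ((ρ ^ (6 * m * k) : (ZMod l)ˣ) : ZMod l) ^ 2 = 1 := by
    rw [← Units.val_pow_eq_pow_val, ← pow_mul,
      show 6 * m * k * 2 = 12 * m * k by ring, h2, Units.val_one]
  rcases sq_eq_sq_iff_eq_or_eq_neg.1 (h3.trans (one_pow 2).symm) with h | h
  · exact absurd (Units.ext h) h1
  · exact h

/-- Auxiliary primes and parameters defining a one-parameter family of imaginary quadratic fields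
whose class groups have `m`-rank at least two. -/
structure FamilyData (m : ℕ) where
  (l₁ l₂ σ w : ℕ)
  [prime₁ : Fact l₁.Prime]
  [prime₂ : Fact l₂.Prime]
  dvd₁ : 12 * m ∣ l₁ - 1
  dvd₂ : 12 * m ∣ l₂ - 1
  ρ₁ : (ZMod l₁)ˣ
  ρ₂ : (ZMod l₂)ˣ
  orderOf₁ : orderOf ρ₁ = l₁ - 1
  orderOf₂ : orderOf ρ₂ = l₂ - 1
  even : 2 ∣ σ
  two_le : 2 ≤ σ
  w_pos : 0 < w
  coprime : IsCoprime (w : ℤ) σ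
  σ₁ : (σ : ZMod l₁) ^ (2 * m) = -1
  σ₂ : (σ : ZMod l₂) = 1
  w₁ : (-2 - 4 * (w * (m * (σ ^ 2) ^ (m - 1))) : ZMod l₁) = ρ₁ + (ρ₁ : ZMod l₁)⁻¹
  w₂ : (2 - 4 * (w * m) : ZMod l₂) = ρ₂ + (ρ₂ : ZMod l₂)⁻¹

theorem natCast_zmod_ne_zero_of_lt {l n : ℕ} (hn : 0 < n) (h : n < l) : (n : ZMod l) ≠ 0 := by
  rw [Ne, ZMod.natCast_eq_zero_iff]
  exact Nat.not_dvd_of_pos_of_lt hn h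

theorem nonempty_familyData {m : ℕ} (hm : 1 < m) : Nonempty (FamilyData m) := by
  obtain ⟨l₁, hp₁, hlt₁, hmod₁⟩ := Nat.exists_prime_gt_modEq_one (k := 12 * m) (12 * m) (by omega)
  obtain ⟨l₂, hp₂, hlt₂, hmod₂⟩ := Nat.exists_prime_gt_modEq_one (k := 12 * m) l₁ (by omega)
  have : Fact l₁.Prime := ⟨hp₁⟩
  have : Fact l₂.Prime := ⟨hp₂⟩
  have : NeZero l₁ := ⟨hp₁.ne_zero⟩
  have : NeZero l₂ := ⟨hp₂.ne_zero⟩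
  have hd₁ : 12 * m ∣ l₁ - 1 := (Nat.modEq_iff_dvd' hp₁.one_lt.le).1 hmod₁.symm
  have hd₂ : 12 * m ∣ l₂ - 1 := (Nat.modEq_iff_dvd' hp₂.one_lt.le).1 hmod₂.symm
  obtain ⟨ρ₁, hρ₁⟩ := ZMod.exists_orderOf_eq_sub_one l₁
  obtain ⟨ρ₂, hρ₂⟩ := ZMod.exists_orderOf_eq_sub_one l₂
  obtain ⟨τ, hτ⟩ := ZMod.exists_pow_two_mul_eq_neg_one hd₁
  have h₁₂ : l₁.Coprime l₂ := (Nat.coprime_primes hp₁ hp₂).2 hlt₂.ne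
  have hc2 : Nat.Coprime 2 (l₁ * l₂) :=
    Nat.Coprime.mul_right ((Nat.coprime_primes Nat.prime_two hp₁).2 (by omega))
      ((Nat.coprime_primes Nat.prime_two hp₂).2 (by omega))
  obtain ⟨σ, hσ₁, hσ₂, hσ⟩ := exists_nat_zmod_eq h₁₂ hc2 τ 1 0
  have hσ0 : σ ≠ 0 := by rintro rfl; simp at hσ₂
  have hσe : 2 ∣ σ := (Nat.modEq_zero_iff_dvd).1 hσ
  have hτ0 : τ ≠ 0 := by
    rintro rfl
    rw [zero_pow (by omega), zero_eq_neg] at hτ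
    exact one_ne_zero hτ
  have hcσ : Nat.Coprime σ (l₁ * l₂) := by
    refine Nat.Coprime.mul_right ?_ ?_
    · rw [← ZMod.isUnit_iff_coprime, hσ₁]; exact hτ0.isUnit
    · rw [← ZMod.isUnit_iff_coprime, hσ₂]; exact isUnit_one
  obtain ⟨w, hw₁, hw₂, hw⟩ := exists_nat_zmod_eq h₁₂ hcσ
    (-(2 + ρ₁ + (ρ₁ : ZMod l₁)⁻¹) / (4 * (m * (τ ^ 2) ^ (m - 1))))
    ((2 - ρ₂ - (ρ₂ : ZMod l₂)⁻¹) / (4 * m)) 1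
  have hwc : w.Coprime σ := by
    rw [Nat.Coprime, hw.gcd_eq, Nat.gcd_one_left]
  have hm₁ : (m : ZMod l₁) ≠ 0 := natCast_zmod_ne_zero_of_lt (by omega) (by omega)
  have hm₂ : (m : ZMod l₂) ≠ 0 := natCast_zmod_ne_zero_of_lt (by omega) (by omega)
  have h4₁ : (4 : ZMod l₁) ≠ 0 :=
    mod_cast natCast_zmod_ne_zero_of_lt (l := l₁) (n := 4) (by omega) (by omega)
  have h4₂ : (4 : ZMod l₂) ≠ 0 :=
    mod_cast natCast_zmod_ne_zero_of_lt (l := l₂) (n := 4) (by omega) (by omega)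
  refine ⟨{ l₁ := l₁, l₂ := l₂, σ := σ, w := w, dvd₁ := hd₁, dvd₂ := hd₂, ρ₁ := ρ₁, ρ₂ := ρ₂,
            orderOf₁ := hρ₁, orderOf₂ := hρ₂, even := hσe, two_le := by omega, w_pos := ?_,
            coprime := Nat.isCoprime_iff_coprime.2 hwc, σ₁ := by rw [hσ₁, hτ], σ₂ := hσ₂,
            w₁ := ?_, w₂ := ?_ }⟩
  · rcases Nat.eq_zero_or_pos w with rfl | h
    · rw [Nat.coprime_zero_left] at hwc; omega
    · exact h
  · rw [hw₁, hσ₁]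
    have hD : 4 * ((m : ZMod l₁) * (τ ^ 2) ^ (m - 1)) ≠ 0 :=
      mul_ne_zero h4₁ (mul_ne_zero hm₁ (pow_ne_zero _ (pow_ne_zero _ hτ0)))
    have := div_mul_cancel₀ (-(2 + ρ₁ + (ρ₁ : ZMod l₁)⁻¹)) hD
    linear_combination -this
  · rw [hw₂]
    have := div_mul_cancel₀ (2 - ρ₂ - (ρ₂ : ZMod l₂)⁻¹) (mul_ne_zero h4₂ hm₂)
    linear_combination -this

theorem exists_family_params {κ m w n : ℕ} (hm : 1 < m) (hκ : 2 ≤ κ) (hw : 0 < w) (hn : 0 < n) :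
    ∃ u v e F : ℕ, (v : ℤ) = 1 + κ * (((κ ^ m) ^ 2 - 1) * w) * n ∧
      (u : ℤ) = κ * v - ((κ ^ m) ^ 2 - 1) * w ∧
      (e : ℤ) = w * ∑ i ∈ Finset.range m, ((κ : ℤ) * v) ^ i * (u : ℤ) ^ (m - 1 - i) ∧
      (((κ : ℤ) ^ m) ^ 2 - 1) * F =
        (κ * u - v) * ∑ i ∈ Finset.range m, ((κ : ℤ) * u) ^ i * (v : ℤ) ^ (m - 1 - i) ∧
      (κ : ℤ) ^ m * F + e = u ^ m ∧ (F : ℤ) + κ ^ m * e = v ^ m ∧ 0 < e ∧ 0 < F ∧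
      ((κ : ℤ) ^ m) ^ 2 * e - e = κ ^ m * v ^ m - u ^ m := by
  have hk : (1 : ℤ) < (κ : ℤ) ^ m := one_lt_pow₀ (by omega) (by omega)
  obtain ⟨k, hkd⟩ : ∃ k : ℤ, k = (κ : ℤ) ^ m := ⟨_, rfl⟩
  have hkc : k = ((κ ^ m : ℕ) : ℤ) := by rw [hkd]; push_cast; rfl
  rw [← hkd] at hk ⊢
  have hw' : (1 : ℤ) ≤ w := by exact_mod_cast hw
  have hn' : (1 : ℤ) ≤ n := by exact_mod_cast hn
  have hκ' : (2 : ℤ) ≤ κ := by exact_mod_cast hκ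
  obtain ⟨W, hW⟩ : ∃ W : ℤ, W = (k ^ 2 - 1) * w := ⟨_, rfl⟩
  have hk2 : 0 < k ^ 2 - 1 := by nlinarith
  have hWpos : 0 < W := by rw [hW]; positivity
  obtain ⟨v, hv⟩ : ∃ v : ℕ, (v : ℤ) = 1 + κ * W * n :=
    ⟨(1 + κ * W * n).toNat, Int.toNat_of_nonneg (by positivity)⟩
  have hvW : κ * W < v := by rw [hv]; nlinarith [mul_pos (by linarith : (0:ℤ) < κ) hWpos]
  obtain ⟨u, hu⟩ : ∃ u : ℕ, (u : ℤ) = κ * v - W :=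
    ⟨(κ * v - W).toNat, Int.toNat_of_nonneg (by nlinarith)⟩
  have hupos : (0 : ℤ) < u := by rw [hu]; nlinarith
  have hvpos : (0 : ℤ) < v := by nlinarith
  have hlt : 0 < (κ : ℤ) * u - v := by
    rw [hu]
    nlinarith [mul_nonneg (by linarith : (0:ℤ) ≤ κ - 2) hvpos.le]
  obtain ⟨e, he⟩ : ∃ e : ℕ,
      (e : ℤ) = w * ∑ i ∈ Finset.range m, ((κ : ℤ) * v) ^ i * (u : ℤ) ^ (m - 1 - i) :=
    ⟨w * ∑ i ∈ Finset.range m, (κ * v) ^ i * u ^ (m - 1 - i), by push_cast; rfl⟩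
  have hS : ∀ x y : ℤ, 0 < x → 0 < y → 0 < ∑ i ∈ Finset.range m, x ^ i * y ^ (m - 1 - i) :=
    fun x y hx hy ↦ Finset.sum_pos (fun i _ ↦ by positivity) ⟨0, by simp; omega⟩
  have hepos : (0 : ℤ) < e := by
    rw [he]; exact mul_pos (by linarith) (hS _ _ (by positivity) hupos)
  have hke : (k ^ 2 - 1) * e = k * v ^ m - u ^ m := by
    have := (Commute.all ((κ : ℤ) * v) u).geom_sum₂_mul m
    rw [mul_pow, ← hkd] at this
    rw [← this, he, hu, hW]
    ring
  have hF : (k ^ 2 - 1) * (v ^ m - k * e) =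
      (κ * u - v) * ∑ i ∈ Finset.range m, ((κ : ℤ) * u) ^ i * (v : ℤ) ^ (m - 1 - i) := by
    have := (Commute.all ((κ : ℤ) * u) v).geom_sum₂_mul m
    rw [mul_pow, ← hkd] at this
    rw [mul_comm (_ - _) (Finset.sum _ _), this]
    linear_combination -k * hke
  have hFpos : 0 < (v : ℤ) ^ m - k * e := by
    refine pos_of_mul_pos_right (a := k ^ 2 - 1) ?_ hk2.le
    rw [hF]
    exact mul_pos hlt (hS _ _ (by positivity) hvpos)
  obtain ⟨F, hFd⟩ : ∃ F : ℕ, (F : ℤ) = v ^ m - k * e := ⟨_, Int.toNat_of_nonneg hFpos.le⟩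
  refine ⟨u, v, e, F, by rw [hv, hW], by rw [hu, hW], he, by rw [hFd, hF], ?_, by rw [hFd]; ring,
    by exact_mod_cast hepos, by exact_mod_cast hFd ▸ hFpos, by linear_combination hke⟩
  rw [hFd]
  linear_combination -hke

theorem FamilyData.exists_injective_classGroup {m : ℕ} (hm : 1 < m) (D : FamilyData m)
    {u v e F n : ℕ}
    (hv : (v : ℤ) = 1 + (D.σ ^ 2 : ℕ) * ((((D.σ ^ 2 : ℕ) ^ m : ℤ) ^ 2 - 1) * D.w) * n)
    (hu : (u : ℤ) = (D.σ ^ 2 : ℕ) * v - (((D.σ ^ 2 : ℕ) ^ m : ℤ) ^ 2 - 1) * D.w)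
    (he : (e : ℤ) = D.w * ∑ i ∈ Finset.range m,
      (((D.σ ^ 2 : ℕ) : ℤ) * v) ^ i * (u : ℤ) ^ (m - 1 - i))
    (hum : ((D.σ ^ 2 : ℕ) : ℤ) ^ m * F + e = u ^ m)
    (hvm : (F : ℤ) + ((D.σ ^ 2 : ℕ) : ℤ) ^ m * e = v ^ m)
    [NumberField (imagQuad (e * F))] :
    ∃ f : (Fin 2 → ZMod m) →+ Additive (ClassGroup (𝓞 (imagQuad (e * F)))),
      Function.Injective f := by
  have := D.prime₁
  have := D.prime₂
  obtain ⟨s, hs⟩ : ∃ s : ℕ, s = D.σ ^ m := ⟨_, rfl⟩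
  have hsk : (((D.σ ^ 2 : ℕ) : ℤ)) ^ m = s ^ 2 := by rw [hs]; push_cast; ring
  rw [hsk] at hv hu hum hvm
  obtain ⟨W, hW⟩ : ∃ W : ℤ, W = (((s : ℤ) ^ 2) ^ 2 - 1) * D.w := ⟨_, rfl⟩
  rw [← hW] at hv hu
  have h2σ : (2 : ℤ) ∣ D.σ := by exact_mod_cast D.even
  have hσs : (D.σ : ℤ) ∣ s := by
    rw [hs]; push_cast; exact dvd_pow_self _ (by omega)
  have h2s : (2 : ℤ) ∣ s := h2σ.trans hσs
  push_cast at hv hu he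
  have hvW : IsCoprime (v : ℤ) W := ⟨1, -(D.σ ^ 2 * n), by rw [hv]; ring⟩
  have hvσ : IsCoprime (v : ℤ) D.σ := ⟨1, -(D.σ * W * n), by rw [hv]; ring⟩
  have hvs : IsCoprime (v : ℤ) s := by
    rw [hs]; push_cast; exact hvσ.pow_right
  have hWσ : IsCoprime W D.σ := by
    rw [hW]
    refine IsCoprime.mul_left ?_ D.coprime
    obtain ⟨c, hc⟩ := hσs
    exact ⟨-1, s ^ 3 * c, by linear_combination -(s : ℤ) ^ 3 * hc⟩
  have huσ : IsCoprime (u : ℤ) D.σ := by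
    rw [hu, show (D.σ : ℤ) ^ 2 * v - W = -W + D.σ * (D.σ * v) by ring]
    exact hWσ.neg_left.add_mul_left_left _
  have hus : IsCoprime (u : ℤ) s := by
    rw [hs]; push_cast; exact huσ.pow_right
  have huv : IsCoprime (u : ℤ) v := by
    rw [hu, show (D.σ : ℤ) ^ 2 * v - W = -W + v * D.σ ^ 2 by ring]
    exact hvW.symm.neg_left.add_mul_left_left _
  have hu2 : IsCoprime (u : ℤ) 2 := huσ.of_isCoprime_of_dvd_right h2σ
  have hv2 : IsCoprime (v : ℤ) 2 := hvσ.of_isCoprime_of_dvd_right h2σ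
  have huW : IsCoprime (u : ℤ) W := by
    rw [hu, show (D.σ : ℤ) ^ 2 * v - W = D.σ ^ 2 * v + W * (-1) by ring]
    exact (IsCoprime.mul_left hWσ.symm.pow_left hvW).add_mul_left_left _
  have hk1 : ((s : ℤ) ^ 2 + 1) ∣ W := ⟨(s ^ 2 - 1) * D.w, by rw [hW]; ring⟩
  have huk := huW.of_isCoprime_of_dvd_right hk1
  have hvk := hvW.of_isCoprime_of_dvd_right hk1
  have hke : (e : ℤ) * ((s ^ 2) ^ 2 - 1) = s ^ 2 * v ^ m - u ^ m := by
    linear_combination -hum + s ^ 2 * hvm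
  have hue : IsCoprime (u : ℤ) e := by
    refine IsCoprime.of_mul_right_left (z := ((s : ℤ) ^ 2) ^ 2 - 1) ?_
    rw [hke, show (s : ℤ) ^ 2 * v ^ m - u ^ m = s ^ 2 * v ^ m + u * -u ^ (m - 1) by
      rw [mul_neg, mul_pow_sub_one (by omega)]; ring]
    exact (hus.pow_right.mul_right huv.pow_right).add_mul_left_right _
  have hve : IsCoprime (v : ℤ) e := by
    refine IsCoprime.of_mul_right_left (z := ((s : ℤ) ^ 2) ^ 2 - 1) ?_
    rw [hke, show (s : ℤ) ^ 2 * v ^ m - u ^ m = -u ^ m + v * (s ^ 2 * v ^ (m - 1)) by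
      rw [mul_left_comm, mul_pow_sub_one (by omega)]; ring]
    exact huv.symm.pow_right.neg_right.add_mul_left_right _
  have hvFe : IsCoprime (v : ℤ) (F - e) := by
    rw [show (F : ℤ) - e = -((s ^ 2 + 1) * e) + v * v ^ (m - 1) by
      rw [mul_pow_sub_one (by omega)]; linear_combination hvm]
    exact (hvk.mul_right hve).neg_right.add_mul_left_right _
  have huFe : IsCoprime (u : ℤ) (F - e) := by
    refine IsCoprime.of_mul_right_right (y := (s : ℤ) ^ 2) ?_
    rw [show (s : ℤ) ^ 2 * (F - e) = -((s ^ 2 + 1) * e) + u * u ^ (m - 1) by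
      rw [mul_pow_sub_one (by omega)]; linear_combination hum]
    exact (huk.mul_right hue).neg_right.add_mul_left_right _
  have hukFe : IsCoprime (u : ℤ) (s ^ 2 * F - e) := by
    rw [show (s : ℤ) ^ 2 * F - e = -(2 * e) + u * u ^ (m - 1) by
      rw [mul_pow_sub_one (by omega)]; linear_combination hum]
    exact (hu2.mul_right hue).neg_right.add_mul_left_right _
  have hs1 : (s : ZMod D.l₁) ^ 2 = -1 := by
    rw [hs, ← D.σ₁]; push_cast; ring
  have hs2 : (s : ZMod D.l₂) = 1 := by
    rw [hs]; push_cast; rw [D.σ₂, one_pow]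
  have key : ∀ l : ℕ, (((s : ZMod l) ^ 2) ^ 2 = 1) →
      (v : ZMod l) = 1 ∧ (u : ZMod l) = (D.σ : ZMod l) ^ 2 ∧
        (e : ZMod l) = D.w * (m * ((D.σ : ZMod l) ^ 2) ^ (m - 1)) := by
    intro l hl
    have hW0 : (W : ZMod l) = 0 := by rw [hW]; push_cast; rw [hl]; ring
    have hv1 : (v : ZMod l) = 1 := by
      have := congrArg (Int.cast : ℤ → ZMod l) hv
      push_cast at this
      rw [this, hW0]; ring
    have hu1 : (u : ZMod l) = (D.σ : ZMod l) ^ 2 := by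
      have := congrArg (Int.cast : ℤ → ZMod l) hu
      push_cast at this
      rw [this, hW0, hv1]; ring
    refine ⟨hv1, hu1, ?_⟩
    have := congrArg (Int.cast : ℤ → ZMod l) he
    push_cast at this
    rw [this, hu1, hv1, mul_one, geom_sum₂_self]
  have hF : ∀ l : ℕ, (v : ZMod l) = 1 → (F : ZMod l) = 1 - (s : ZMod l) ^ 2 * e := by
    intro l hl
    have := congrArg (Int.cast : ℤ → ZMod l) hvm
    push_cast at this
    rw [hl, one_pow] at this
    linear_combination this
  obtain ⟨hv1, hu1, he1⟩ := key D.l₁ (by rw [hs1]; ring)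
  obtain ⟨hv2', hu2', he2⟩ := key D.l₂ (by rw [hs2]; ring)
  have hF1 := hF _ hv1
  have hF2 := hF _ hv2'
  rw [hs1] at hF1
  rw [hs2] at hF2
  rw [D.σ₂, one_pow, one_pow, mul_one] at he2
  refine imagQuad.exists_injective_classGroup (m := m) (s := s) (e := e) (F := F) (u := u) (v := v)
    (τ := D.σ) (l₁ := D.l₁) (l₂ := D.l₂) hm (by exact_mod_cast hum) (by exact_mod_cast hvm)
    (hu2.mul_right hukFe) ?_ D.dvd₁ D.dvd₂ D.orderOf₁ D.orderOf₂ (by rw [hs]; push_cast; rfl)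
    hs1 hs2 ?_ ?_ ?_ ?_
  · exact IsCoprime.mul_left ((hu2.mul_right hus).mul_right huFe)
      ((hv2.mul_right hvs).mul_right hvFe)
  · rw [hF1]; ring
  · rw [← D.w₁, hF1, ← he1]; ring
  · rw [hF2]; ring
  · rw [← D.w₂, hF2, ← he2]; ring

theorem exists_natCast_dvd_mul_sub {q : ℕ} (hq : q.Prime) {a b : ℤ} (ha : ¬(q : ℤ) ∣ a) :
    ∃ n : ℕ, q ≤ n ∧ n < 2 * q ∧ (q : ℤ) ∣ a * n - b := by
  have : Fact q.Prime := ⟨hq⟩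
  have ha' : (a : ZMod q) ≠ 0 := by rwa [Ne, ZMod.intCast_zmod_eq_zero_iff_dvd]
  have := ZMod.val_lt ((b : ZMod q) / (a : ZMod q))
  refine ⟨((b : ZMod q) / (a : ZMod q)).val + q, by omega, by omega, ?_⟩
  rw [← ZMod.intCast_zmod_eq_zero_iff_dvd]
  push_cast
  rw [ZMod.natCast_zmod_val, CharP.cast_eq_zero, add_zero, mul_div_cancel₀ _ ha', sub_self]

theorem not_natCast_dvd_of_lt {q : ℕ} {a : ℤ} (h0 : 0 < a) (h : a < q) : ¬(q : ℤ) ∣ a :=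
  fun hd ↦ absurd (Int.le_of_dvd h0 hd) (by omega)

theorem family_mul_le {κ m w W n q u v e F k : ℕ} (hm : 1 < m) (hq : 0 < q) (hn : n < 2 * q)
    (hv : v = 1 + κ * W * n) (hu : u ≤ κ * v)
    (he : e = w * ∑ i ∈ Finset.range m, (κ * v) ^ i * u ^ (m - 1 - i)) (hvm : F + k * e = v ^ m) :
    e * F ≤ w * m * κ ^ (m - 1) * (1 + 2 * κ * W) ^ (2 * m - 1) * q ^ (2 * m - 1) := by
  have hvq : v ≤ (1 + 2 * κ * W) * q := by
    rw [hv]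
    nlinarith [Nat.mul_le_mul_left (κ * W) hn.le]
  have hele : e ≤ w * (m * (κ * v) ^ (m - 1)) := by
    rw [he]
    refine Nat.mul_le_mul_left _ ?_
    calc ∑ i ∈ Finset.range m, (κ * v) ^ i * u ^ (m - 1 - i)
        ≤ ∑ i ∈ Finset.range m, (κ * v) ^ i * (κ * v) ^ (m - 1 - i) := by gcongr
      _ = _ := by rw [geom_sum₂_self, Nat.cast_id]
  calc e * F ≤ w * (m * (κ * v) ^ (m - 1)) * v ^ m := Nat.mul_le_mul hele (by omega)
    _ = w * m * κ ^ (m - 1) * v ^ (2 * m - 1) := by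
      rw [show 2 * m - 1 = (m - 1) + m by omega, mul_pow, pow_add]; ring
    _ ≤ w * m * κ ^ (m - 1) * ((1 + 2 * κ * W) * q) ^ (2 * m - 1) := by gcongr
    _ = _ := by rw [mul_pow]; ring

theorem family_sub_bounds {κ W n q u v : ℤ} (hκ : 2 ≤ κ) (hW : 0 < W) (hn : 1 ≤ n)
    (hnq : n ≤ 2 * q) (hv : v = 1 + κ * W * n) (hu : u = κ * v - W)
    (hq : κ ^ 2 * (1 + 2 * κ * W) < q) : 0 < κ * u - v ∧ κ * u - v < q ^ 2 := by
  have hκW : 0 < κ * W := by positivity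
  have hκ2 : 4 ≤ κ ^ 2 := by nlinarith
  have hvW : κ * W < v := by rw [hv]; nlinarith
  have h : κ * u - v = (κ ^ 2 - 1) * v - κ * W := by rw [hu]; ring
  have hq1 : 1 ≤ q := by nlinarith
  have hvq : v ≤ (1 + 2 * κ * W) * q := by
    rw [hv]
    nlinarith [mul_le_mul_of_nonneg_left hnq hκW.le]
  rw [h]
  constructor
  · nlinarith [mul_le_mul_of_nonneg_right hκ2 (hκW.trans hvW).le]
  · calc (κ ^ 2 - 1) * v - κ * W < κ ^ 2 * v := by linarith
      _ ≤ κ ^ 2 * ((1 + 2 * κ * W) * q) := by gcongr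
      _ = κ ^ 2 * (1 + 2 * κ * W) * q := by ring
      _ ≤ q * q := by gcongr
      _ = q ^ 2 := by ring

theorem exists_family_params_prime {κ m w : ℕ} (hm : 1 < m) (hκ : 2 ≤ κ) (hw : 0 < w) :
    ∃ C Q₀ : ℕ, 0 < C ∧ ∀ q : ℕ, q.Prime → Q₀ < q → ∃ n u v e F : ℕ,
      (v : ℤ) = 1 + κ * (((κ ^ m) ^ 2 - 1) * w) * n ∧
      (u : ℤ) = κ * v - ((κ ^ m) ^ 2 - 1) * w ∧
      (e : ℤ) = w * ∑ i ∈ Finset.range m, ((κ : ℤ) * v) ^ i * (u : ℤ) ^ (m - 1 - i) ∧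
      (κ : ℤ) ^ m * F + e = u ^ m ∧ (F : ℤ) + κ ^ m * e = v ^ m ∧ 0 < e * F ∧
      e * F ≤ C * q ^ (2 * m - 1) ∧ q ∣ e * F ∧ ¬q ^ 2 ∣ e * F := by
  have hk : 1 < κ ^ m := one_lt_pow₀ (by omega) (by omega)
  obtain ⟨W, hW⟩ : ∃ W : ℕ, (W : ℤ) = (((κ : ℤ) ^ m) ^ 2 - 1) * w :=
    ⟨((κ ^ m) ^ 2 - 1) * w, by
      rw [Nat.cast_mul, Nat.cast_sub (Nat.one_le_pow _ _ (by omega))]; push_cast; rfl⟩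
  have hkW : ((κ : ℤ) ^ m) ^ 2 - 1 ≤ W := by
    have : (1 : ℤ) < (κ : ℤ) ^ m := by exact_mod_cast hk
    have : (1 : ℤ) ≤ w := by exact_mod_cast hw
    rw [hW]; nlinarith
  have hk0 : (0 : ℤ) < ((κ : ℤ) ^ m) ^ 2 - 1 := by
    have : (1 : ℤ) < (κ : ℤ) ^ m := by exact_mod_cast hk
    nlinarith
  have hW0 : 0 < W := by omega
  refine ⟨w * m * κ ^ (m - 1) * (1 + 2 * κ * W) ^ (2 * m - 1), m + κ ^ 2 * (1 + 2 * κ * W),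
    by positivity, fun q hq hQ ↦ ?_⟩
  have hqp : Prime (q : ℤ) := Nat.prime_iff_prime_int.1 hq
  have hmq : m < q := by omega
  have hκq : κ ^ 2 * (1 + 2 * κ * W) < q := by omega
  have hWq : W < q := by
    nlinarith [Nat.pos_of_ne_zero (by positivity : κ ^ 2 ≠ 0), Nat.mul_le_mul hκ (le_refl W)]
  have hκ2q : κ ^ 2 < q := by nlinarith [Nat.zero_le (κ ^ 2 * (2 * κ * W))]
  have hκ' : (2 : ℤ) ≤ κ := by exact_mod_cast hκ
  have hκ2q' : (κ : ℤ) ^ 2 < q := by exact_mod_cast hκ2q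
  have hqκ : ¬(q : ℤ) ∣ κ := not_natCast_dvd_of_lt (by omega) (by nlinarith)
  have hqW : ¬(q : ℤ) ∣ W := not_natCast_dvd_of_lt (by omega) (by omega)
  have hqm : ¬(q : ℤ) ∣ m := not_natCast_dvd_of_lt (by omega) (by omega)
  have hqκ2 : ¬(q : ℤ) ∣ κ ^ 2 - 1 := not_natCast_dvd_of_lt (by nlinarith) (by omega)
  have hqk : ¬(q : ℤ) ∣ ((κ : ℤ) ^ m) ^ 2 - 1 := not_natCast_dvd_of_lt hk0 (by omega)
  obtain ⟨n, hn₁, hn₂, hn⟩ := exists_natCast_dvd_mul_sub hq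
    (a := ((κ : ℤ) ^ 2 - 1) * κ * W) (b := κ * W - (κ ^ 2 - 1))
    (hqp.not_dvd_mul (hqp.not_dvd_mul hqκ2 hqκ) hqW)
  obtain ⟨u, v, e, F, hv, hu, he, hF, hum, hvm, he0, hF0, -⟩ :=
    exists_family_params (n := n) hm hκ hw (hq.pos.trans_le hn₁)
  refine ⟨n, u, v, e, F, hv, hu, he, hum, hvm, Nat.mul_pos he0 hF0, ?_, ?_⟩
  · rw [← hW] at hv hu
    have huv : u ≤ κ * v := by zify; omega
    exact family_mul_le hm hq.pos hn₂ (by exact_mod_cast hv) huv (by exact_mod_cast he)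
      (by exact_mod_cast hvm)
  · rw [← hW] at hv hu
    have hlin : (κ : ℤ) * u - v = (κ ^ 2 - 1) * κ * W * n - (κ * W - (κ ^ 2 - 1)) := by
      rw [hu, hv]; ring
    rw [← hlin] at hn
    have hqu : ¬(q : ℤ) ∣ u := by
      intro h
      have hqv : (q : ℤ) ∣ v := by
        have := (h.mul_left (κ : ℤ)).sub hn
        rwa [sub_sub_cancel] at this
      refine hqW ?_
      have := (hqv.mul_left (κ : ℤ)).sub h
      rwa [hu, sub_sub_cancel] at this
    have hqF : (q : ℤ) ∣ F := by
      refine (hqp.dvd_or_dvd ?_).resolve_left hqk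
      rw [hF]
      exact hn.mul_right _
    have hqe : ¬(q : ℤ) ∣ e := by
      intro h
      refine hqu (hqp.dvd_of_dvd_pow (n := m) ?_)
      rw [← hum]
      exact (hqF.mul_left _).add h
    have hqS : ¬(q : ℤ) ∣ ∑ i ∈ Finset.range m, ((κ : ℤ) * u) ^ i * (v : ℤ) ^ (m - 1 - i) := by
      have h1 : (((κ : ℤ) * u : ℤ) : ZMod q) = ((v : ℤ) : ZMod q) := by
        rw [ZMod.intCast_eq_intCast_iff_dvd_sub, ← neg_sub, dvd_neg]; exact hn
      have h2 : ((∑ i ∈ Finset.range m, ((κ : ℤ) * u) ^ i * (v : ℤ) ^ (m - 1 - i) : ℤ) : ZMod q) =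
          ((m * (κ * u) ^ (m - 1) : ℤ) : ZMod q) := by
        push_cast at h1 ⊢
        rw [← h1, geom_sum₂_self]
      rw [← ZMod.intCast_zmod_eq_zero_iff_dvd, h2, ZMod.intCast_zmod_eq_zero_iff_dvd]
      exact hqp.not_dvd_mul hqm fun h ↦ hqp.not_dvd_mul hqκ hqu (hqp.dvd_of_dvd_pow h)
    refine ⟨(Int.natCast_dvd_natCast.1 hqF).mul_left e, fun h ↦ ?_⟩
    have h' : (q : ℤ) ^ 2 ∣ e * F := by exact_mod_cast h
    have hF2 : (q : ℤ) ^ 2 ∣ F :=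
      (hqp.pow_dvd_of_dvd_mul_left 2 hqe h')
    have h3 : (q : ℤ) ^ 2 ∣ κ * u - v :=
      hqp.pow_dvd_of_dvd_mul_right 2 hqS (hF ▸ hF2.mul_left _)
    have hn1 : (1 : ℤ) ≤ n := by have := hq.pos; omega
    obtain ⟨h4, h5⟩ := family_sub_bounds (q := q) hκ' (by exact_mod_cast hW0) hn1 (by omega) hv hu
      (by exact_mod_cast hκq)
    exact absurd (Int.le_of_dvd h4 h3) (not_le.2 h5)

theorem exists_family {m : ℕ} (hm : 1 < m) :
    ∃ C Q₀ : ℕ, 0 < C ∧ ∀ q : ℕ, q.Prime → Q₀ < q → ∃ d : ℕ, 0 < d ∧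
      d ≤ C * q ^ (2 * m - 1) ∧ q ∣ d ∧ ¬q ^ 2 ∣ d ∧ ∀ [NumberField (imagQuad d)],
        ∃ f : (Fin 2 → ZMod m) →+ Additive (ClassGroup (𝓞 (imagQuad d))),
          Function.Injective f := by
  obtain ⟨D⟩ := nonempty_familyData hm
  have hκ : 2 ≤ D.σ ^ 2 := by nlinarith [D.two_le]
  obtain ⟨C, Q₀, hC, h⟩ := exists_family_params_prime hm hκ D.w_pos
  refine ⟨C, Q₀, hC, fun q hq hQ ↦ ?_⟩
  obtain ⟨n, u, v, e, F, hv, hu, he, hum, hvm, h0, hle, hd, hd2⟩ := h q hq hQ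
  exact ⟨e * F, h0, hle, hd, hd2, fun {_} ↦ D.exists_injective_classGroup hm hv hu he hum hvm⟩

theorem Nat.Prime.dvd_of_mul_eq_sq {q a b y : ℕ} (hq : q.Prime) (h : a * b = y ^ 2) (ha : q ∣ a)
    (ha2 : ¬q ^ 2 ∣ a) : q ∣ b := by
  by_contra hb
  have hy : q ∣ y := hq.dvd_of_dvd_pow (h ▸ ha.mul_right b)
  have h2 : q ^ 2 ∣ a * b := h ▸ pow_dvd_pow_of_dvd hy 2
  exact ha2 (((hq.coprime_iff_not_dvd.2 hb).pow_left 2).dvd_of_dvd_mul_right h2)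

/-- The primes `q ≤ N` with `N < q ^ 2`. -/
def largePrimes (N : ℕ) : Finset ℕ := (Nat.primesLE N).filter fun q ↦ N < q ^ 2

theorem mem_largePrimes {N q : ℕ} : q ∈ largePrimes N ↔ (q ≤ N ∧ q.Prime) ∧ N < q ^ 2 := by
  rw [largePrimes, Finset.mem_filter, Nat.mem_primesLE]

theorem card_le_of_mul_eq_sq {m C N : ℕ} (hm : 0 < m) (hC : C ^ 2 ≤ N) (hN : 2 ≤ N) {d : ℕ → ℕ}
    {T : Finset ℕ} (hT : T ⊆ largePrimes N) (hpos : ∀ q ∈ T, 0 < d q)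
    (hle : ∀ q ∈ T, d q ≤ C * q ^ (2 * m - 1)) (hdvd : ∀ q ∈ T, q ∣ d q)
    (hdvd' : ∀ q ∈ T, ¬q ^ 2 ∣ d q) (h : ∀ q ∈ T, ∀ q' ∈ T, ∃ y, d q * d q' = y ^ 2) :
    T.card ≤ 4 * m := by
  rcases T.eq_empty_or_nonempty with rfl | ⟨q₀, hq₀⟩
  · simp
  have hP := fun q (hq : q ∈ T) ↦ mem_largePrimes.1 (hT hq)
  have hprod : ∏ q ∈ T, q ∣ d q₀ := by
    refine Finset.prod_primes_dvd _ (fun q hq ↦ (hP q hq).1.2.prime) fun q hq ↦ ?_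
    obtain ⟨y, hy⟩ := h q hq q₀ hq₀
    exact (hP q hq).1.2.dvd_of_mul_eq_sq hy (hdvd q hq) (hdvd' q hq)
  refine (Nat.pow_le_pow_iff_right (show 1 < N by omega)).1 ?_
  calc N ^ T.card = ∏ q ∈ T, N := by rw [Finset.prod_const]
    _ ≤ ∏ q ∈ T, q ^ 2 := Finset.prod_le_prod' fun q hq ↦ (hP q hq).2.le
    _ = (∏ q ∈ T, q) ^ 2 := Finset.prod_pow _ _ _
    _ ≤ (d q₀) ^ 2 := by gcongr; exact Nat.le_of_dvd (hpos _ hq₀) hprod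
    _ ≤ (C * N ^ (2 * m - 1)) ^ 2 := by
      gcongr
      exact (hle _ hq₀).trans (by gcongr; exact (hP _ hq₀).1.1)
    _ = C ^ 2 * N ^ (4 * m - 2) := by
      rw [mul_pow, ← pow_mul]; congr 2; omega
    _ ≤ N * N ^ (4 * m - 2) := by gcongr
    _ = N ^ (4 * m - 1) := by rw [← pow_succ']; congr 1; omega
    _ ≤ N ^ (4 * m) := by gcongr <;> omega

theorem primeCounting_le_card_largePrimes_add (N : ℕ) :
    Nat.primeCounting N ≤ (largePrimes N).card + Nat.sqrt N := by
  rw [← Nat.primesLE_card_eq_primeCounting]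
  calc (Nat.primesLE N).card ≤ (largePrimes N ∪ Finset.Icc 1 (Nat.sqrt N)).card := by
        refine Finset.card_le_card fun q hq ↦ ?_
        rw [Nat.mem_primesLE] at hq
        rw [Finset.mem_union, mem_largePrimes, Finset.mem_Icc, Nat.le_sqrt']
        by_cases h : N < q ^ 2
        · exact .inl ⟨hq, h⟩
        · exact .inr ⟨hq.2.pos, not_lt.1 h⟩
    _ ≤ _ := (Finset.card_union_le _ _).trans (by simp)

theorem eventually_le_card_largePrimes :
    ∀ᶠ N : ℕ in Filter.atTop, (N : ℝ) / (4 * Real.log N) ≤ (largePrimes N).card := by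
  have hlog := ((isLittleO_log_rpow_atTop (r := 1 / 2) (by norm_num)).bound
    (c := 1 / 10) (by norm_num))
  filter_upwards [tendsto_natCast_atTop_atTop.eventually hlog, Filter.eventually_ge_atTop 2]
    with N hN hN2
  have hN2' : (2 : ℝ) ≤ N := by exact_mod_cast hN2
  have hlogpos : 0 < Real.log N := Real.log_pos (by linarith)
  rw [← Real.sqrt_eq_rpow, Real.norm_of_nonneg hlogpos.le,
    Real.norm_of_nonneg (Real.sqrt_nonneg _)] at hN
  have hsq := Real.mul_self_sqrt (show (0 : ℝ) ≤ N by linarith)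
  have hs1 : 1 ≤ √(N : ℝ) := Real.one_le_sqrt.2 (by linarith)
  have hlog1 : Real.log (N + 1) ≤ 2 * Real.log N := by
    rw [← Real.log_rpow (by linarith)]
    exact Real.log_le_log (by linarith) (by norm_num; nlinarith)
  have h1 := Chebyshev.pi_ge N
  have h2 : (Nat.primeCounting N : ℝ) ≤ (largePrimes N).card + √(N : ℝ) := by
    have : (Nat.primeCounting N : ℝ) ≤ (largePrimes N).card + (Nat.sqrt N : ℝ) := by
      exact_mod_cast primeCounting_le_card_largePrimes_add N
    exact this.trans (by gcongr; exact Real.nat_sqrt_le_real_sqrt)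
  rw [div_le_iff₀ hlogpos] at h1
  rw [div_le_iff₀ (by positivity)]
  have h3 := mul_le_mul_of_nonneg_right h2 hlogpos.le
  have h4 : √(N : ℝ) * Real.log N ≤ N / 10 := by nlinarith
  nlinarith [Real.log_two_gt_d9]

/-- Let `m > 1`. There are `≫ X^(1/(2m−1))/log X` imaginary quadratic fields `k` with `|Disc(k)| < X` and `rank_m Cl(k) ≥ 2`. -/
theorem yamamoto_imaginary_quantitative (m : ℕ) (hm : 1 < m) :
    ∃ c : ℝ, 0 < c ∧ ∃ X₀ : ℝ, ∀ X : ℝ, X₀ ≤ X →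
      ∃ S : Finset (Subfield ℂ),
        -- the fields in `S` are pairwise non-isomorphic
        (∀ K ∈ S, ∀ L ∈ S, Nonempty (↥K ≃+* ↥L) → K = L) ∧
        (∀ K ∈ S,
          -- `K` is a quadratic field of the prescribed signature
          Module.finrank ℚ ↥K = 2 ∧
          (∀ φ : ↥K →+* ℂ, ∃ a : ↥K, (φ a).im ≠ 0) ∧
          NumberField ↥K ∧
          (∀ [NumberField ↥K],
            -- `|Disc K| < X`
            |(NumberField.discr ↥K : ℝ)| < X ∧
            -- the `m`-rank condition on the class group
            ∃ f : (Fin 2 → ZMod m) →+ Additive (ClassGroup (𝓞 ↥K)), Function.Injective f)) ∧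
        c * X ^ (1 / (2 * (m : ℝ) - 1)) / Real.log X ≤ S.card := by
  classical
  obtain ⟨C, Q₀, hC, h⟩ := exists_family hm
  choose! d hd0 hdle hdvd hdvd2 hdcl using h
  have hm' : (1 : ℝ) < m := by exact_mod_cast hm
  have hC' : (1 : ℝ) ≤ C := by exact_mod_cast hC
  obtain ⟨r, hr⟩ : ∃ r : ℝ, r = 1 / (2 * (m : ℝ) - 1) := ⟨_, rfl⟩
  have hr0 : 0 < r := by rw [hr]; exact one_div_pos.2 (by linarith)
  have hr1 : r ≤ 1 := by rw [hr]; exact div_le_one_of_le₀ (by linarith) (by linarith)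
  have hrm : r * ((2 * m - 1 : ℕ) : ℝ) = 1 := by
    rw [hr, Nat.cast_sub (by omega)]; push_cast
    exact one_div_mul_cancel (by linarith)
  rw [← hr]
  have hY : Filter.Tendsto (fun X : ℝ ↦ (X / (8 * C)) ^ r) Filter.atTop Filter.atTop :=
    (tendsto_rpow_atTop hr0).comp (Filter.tendsto_id.atTop_div_const (by positivity))
  have hev := (tendsto_nat_floor_atTop (α := ℝ)).eventually
    (eventually_le_card_largePrimes.and (Filter.eventually_ge_atTop (Q₀ ^ 2 + C ^ 2 + 2)))
  refine ⟨((8 * C : ℝ) ^ r)⁻¹ / (32 * m), by positivity, Filter.eventually_atTop.1 ?_⟩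
  filter_upwards [hY.eventually hev, Filter.eventually_ge_atTop (8 * C : ℝ)] with X hX hXC
  obtain ⟨Y, hYd⟩ : ∃ Y : ℝ, Y = (X / (8 * C)) ^ r := ⟨_, rfl⟩
  rw [← hYd] at hX
  obtain ⟨N, hNd⟩ : ∃ N : ℕ, N = ⌊Y⌋₊ := ⟨_, rfl⟩
  change (_ ∧ _) at hX
  rw [← hNd] at hX
  obtain ⟨hcard, hN⟩ := hX
  have hX0 : 0 < X := by linarith
  have hY0 : 0 < Y := by rw [hYd]; positivity
  have hNY : (N : ℝ) ≤ Y := hNd ▸ Nat.floor_le hY0.le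
  have hYN : Y < N + 1 := hNd ▸ Nat.lt_floor_add_one Y
  have hN2 : (2 : ℝ) ≤ N := by exact_mod_cast (by omega : 2 ≤ N)
  have hYX : Y ≤ X := by
    rw [hYd]
    calc (X / (8 * C)) ^ r ≤ (X / (8 * C)) ^ (1 : ℝ) :=
          Real.rpow_le_rpow_of_exponent_le ((one_le_div (by linarith)).2 hXC) hr1
      _ = X / (8 * C) := Real.rpow_one _
      _ ≤ X := div_le_self hX0.le (by linarith)
  have hYpow : Y ^ (2 * m - 1) = X / (8 * C) := by
    rw [hYd, ← Real.rpow_natCast, ← Real.rpow_mul (by positivity), hrm, Real.rpow_one]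
  have hQ : ∀ q ∈ largePrimes N, q.Prime ∧ Q₀ < q := by
    intro q hq
    rw [mem_largePrimes] at hq
    exact ⟨hq.1.2, lt_of_pow_lt_pow_left₀ 2 (Nat.zero_le _) (by omega)⟩
  refine ⟨(largePrimes N).image fun q ↦ imagQuad (d q), ?_, ?_, ?_⟩
  · simp only [Finset.forall_mem_image]
    exact fun q _ q' _ e ↦ imagQuad.eq_of_ringEquiv e
  · simp only [Finset.forall_mem_image]
    intro q hq
    obtain ⟨hqp, hqQ⟩ := hQ q hq
    have h0 := hd0 q hqp hqQ
    refine ⟨imagQuad.finrank_eq_two h0, imagQuad.exists_im_ne_zero h0, imagQuad.numberField h0,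
      fun {_} ↦ ⟨?_, hdcl q hqp hqQ⟩⟩
    have h1 : |(discr (imagQuad (d q)) : ℝ)| ≤ 4 * d q := by
      exact_mod_cast imagQuad.abs_discr_le h0
    have h2 : (d q : ℝ) ≤ C * (q : ℝ) ^ (2 * m - 1) := by exact_mod_cast hdle q hqp hqQ
    have h3 : (q : ℝ) ≤ Y :=
      (Nat.cast_le.2 (mem_largePrimes.1 hq).1.1).trans hNY
    calc |(discr (imagQuad (d q)) : ℝ)| ≤ 4 * (C * (q : ℝ) ^ (2 * m - 1)) := by linarith
      _ ≤ 4 * (C * Y ^ (2 * m - 1)) := by gcongr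
      _ = X / 2 := by rw [hYpow]; field_simp; ring
      _ < X := by linarith
  · have hS := Finset.card_le_mul_card_image (f := fun q ↦ imagQuad (d q)) (largePrimes N) (4 * m)
      fun K _ ↦ by
        refine card_le_of_mul_eq_sq (C := C) (d := d) (N := N) (by omega) (by nlinarith) (by omega)
          (Finset.filter_subset _ _) ?_ ?_ ?_ ?_ ?_
        all_goals intro q hq; rw [Finset.mem_filter] at hq; obtain ⟨hqp, hqQ⟩ := hQ q hq.1
        · exact hd0 q hqp hqQ
        · exact hdle q hqp hqQ
        · exact hdvd q hqp hqQ
        · exact hdvd2 q hqp hqQ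
        · intro q' hq'
          rw [Finset.mem_filter] at hq'
          exact imagQuad.exists_mul_eq_sq (hd0 q hqp hqQ) (hq.2.trans hq'.2.symm)
    obtain ⟨t, ht⟩ : ∃ t : ℕ, t = ((largePrimes N).image fun q ↦ imagQuad (d q)).card := ⟨_, rfl⟩
    rw [← ht] at hS ⊢
    have hS' : ((largePrimes N).card : ℝ) ≤ 4 * m * t := by exact_mod_cast hS
    have hlogN : 0 < Real.log N := Real.log_pos (by linarith)
    have hlogNX : Real.log N ≤ Real.log X := Real.log_le_log (by linarith) (hNY.trans hYX)
    have hlogX := hlogN.trans_le hlogNX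
    have hYr : ((8 * C : ℝ) ^ r)⁻¹ * X ^ r = Y := by
      rw [hYd, Real.div_rpow hX0.le (by positivity)]; ring
    calc ((8 * C : ℝ) ^ r)⁻¹ / (32 * m) * X ^ r / Real.log X
        = Y / 2 / (4 * Real.log X) / (4 * m) := by rw [← hYr]; field_simp; norm_num
      _ ≤ N / (4 * Real.log N) / (4 * m) := by
        gcongr
        linarith
      _ ≤ 4 * m * t / (4 * m) := by
        gcongr
        exact hcard.trans hS'
      _ = t := mul_div_cancel_left₀ _ (by positivity)
end
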